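/- The alternating group Alt(5) (the alternating group on 5 points) has exactly 240 proper skew morphisms; that is, the number of bijections φ : Alt(5) → Alt(5) with φ(1) = 1 that admit a power function π : Alt(5) → ℕ satisfying φ(a·b) = φ(a)·φ^{π(a)}(b) for all a, b, and that are not group homomorphisms, is 240. -/

import Mathlib

/-- A skew morphism of a group `B`: a bijection fixing `1` admitting a power
function `π` with `φ (a * b) = φ a * φ^[π a] b`. -/
def IsSkewMorphism {B : Type*} [Group B] (φ : B → B) : Prop :=
  Function.Bijective φ ∧ φ 1 = 1 ∧
    ∃ π : B → ℕ, ∀ a b : B, φ (a * b) = φ a * φ^[π a] b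

/-- A proper skew morphism: a skew morphism that is not a group homomorphism. -/
def IsProperSkewMorphism {B : Type*} [Group B] (φ : B → B) : Prop :=
  IsSkewMorphism φ ∧ ¬ (∀ a b : B, φ (a * b) = φ a * φ b)

set_option linter.unusedSectionVars false
set_option linter.unusedVariables false


/-- Reciprocal data of a skew morphism. -/
structure SK {B : Type*} [Group B] (φ : Equiv.Perm B) (n : ℕ)
    (σ : B → ZMod n → ZMod n) : Prop where
  map_one : φ 1 = 1
  ord : orderOf φ = n
  rel : ∀ (a : B) (j : ZMod n) (b : B),
    (φ ^ j.val) (a * b) = (φ ^ j.val) a * (φ ^ (σ a j).val) b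

/-- Skew permutations. -/
def Skew {B : Type*} [Group B] (φ : Equiv.Perm B) : Prop :=
  φ 1 = 1 ∧ ∀ a : B, ∃ k : ℕ, ∀ b : B, φ (a * b) = φ a * (φ ^ k) b

/-- Proper skew permutations. -/
def PSkew {B : Type*} [Group B] (φ : Equiv.Perm B) : Prop :=
  Skew φ ∧ ¬ (∀ a b : B, φ (a * b) = φ a * φ b)

theorem Skew.pow_rel {B : Type*} [Group B] {φ : Equiv.Perm B} (h : Skew φ) (j : ℕ) :
    ∀ a : B, ∃ k : ℕ, ∀ b : B, (φ ^ j) (a * b) = (φ ^ j) a * (φ ^ k) b := by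
  induction j with
  | zero => intro a; exact ⟨0, fun b => by simp⟩
  | succ j ih =>
    intro a
    obtain ⟨k, hk⟩ := ih a
    have : ∀ k : ℕ, ∀ a : B, ∃ s : ℕ, ∀ b, φ (a * (φ ^ k) b) = φ a * (φ ^ s) b := by
      intro k a
      obtain ⟨s, hs⟩ := h.2 a
      exact ⟨s + k, fun b => by rw [hs, pow_add, Equiv.Perm.mul_apply]⟩
    obtain ⟨s, hs⟩ := this k ((φ ^ j) a)
    refine ⟨s, fun b => ?_⟩
    rw [pow_succ', Equiv.Perm.mul_apply, Equiv.Perm.mul_apply, hk, hs]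

theorem Skew.exists_SK {B : Type*} [Group B] [Finite B] {φ : Equiv.Perm B} (h : Skew φ) :
    ∃ σ : B → ZMod (orderOf φ) → ZMod (orderOf φ), SK φ (orderOf φ) σ := by
  choose s hs using h.pow_rel
  have : NeZero (orderOf φ) := ⟨(orderOf_pos φ).ne'⟩
  refine ⟨fun a j => (s j.val a : ℕ), h.1, rfl, fun a j b => ?_⟩
  rw [hs, ZMod.val_natCast, pow_mod_orderOf]

namespace SK

variable {B : Type*} [Group B] [Finite B] {φ : Equiv.Perm B} {n : ℕ} [NeZero n]
  {σ : B → ZMod n → ZMod n}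

theorem pow_add (h : SK φ n σ) (x y : ZMod n) :
    φ ^ (x + y).val = φ ^ x.val * φ ^ y.val := by
  rw [← _root_.pow_add, pow_eq_pow_iff_modEq, h.ord, ZMod.val_add]
  exact Nat.mod_modEq _ _

theorem pow_inj (h : SK φ n σ) {x y : ZMod n} (e : φ ^ x.val = φ ^ y.val) : x = y := by
  rw [pow_eq_pow_iff_modEq, h.ord] at e
  have := (ZMod.natCast_eq_natCast_iff _ _ _).2 e
  simpa using this

theorem pow_natCast (h : SK φ n σ) (k : ℕ) : φ ^ ((k : ZMod n)).val = φ ^ k := by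
  rw [pow_eq_pow_iff_modEq, h.ord, ZMod.val_natCast]
  exact Nat.mod_modEq _ _

theorem mul (h : SK φ n σ) (a b : B) (j : ZMod n) : σ (a * b) j = σ b (σ a j) := by
  apply h.pow_inj
  ext c
  have h1 := h.rel (a * b) j c
  rw [mul_assoc, h.rel, h.rel, h.rel a j b] at h1
  rw [mul_assoc] at h1
  exact (mul_left_cancel (mul_left_cancel h1)).symm

theorem fix_one (h : SK φ n σ) (j : ZMod n) : (φ ^ j.val) 1 = 1 := by
  induction j.val with
  | zero => rfl
  | succ k ih => rw [pow_succ, Equiv.Perm.mul_apply, h.map_one, ih]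

theorem one (h : SK φ n σ) (j : ZMod n) : σ 1 j = j := by
  apply h.pow_inj
  ext c
  have := h.rel 1 j c
  rw [h.fix_one, one_mul, one_mul] at this
  exact this.symm

theorem zero (h : SK φ n σ) (a : B) : σ a 0 = 0 := by
  apply h.pow_inj
  ext c
  have := h.rel a 0 c
  simp only [ZMod.val_zero, pow_zero, Equiv.Perm.one_apply] at this ⊢
  exact (mul_left_cancel this).symm

theorem add (h : SK φ n σ) (a : B) (x j : ZMod n) :
    σ a (x + j) = σ ((φ ^ j.val) a) x + σ a j := by
  apply h.pow_inj
  ext c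
  have h1 := h.rel a (x + j) c
  rw [h.pow_add, Equiv.Perm.mul_apply, Equiv.Perm.mul_apply, h.rel a j c, h.rel] at h1
  rw [h.pow_add, Equiv.Perm.mul_apply]
  exact (mul_left_cancel h1).symm

theorem inv_apply (h : SK φ n σ) (a : B) (x : ZMod n) : σ a⁻¹ (σ a x) = x := by
  rw [← h.mul, mul_inv_cancel, h.one]

theorem apply_inv (h : SK φ n σ) (a : B) (x : ZMod n) : σ a (σ a⁻¹ x) = x := by
  rw [← h.mul, inv_mul_cancel, h.one]

theorem inj (h : SK φ n σ) (a : B) : Function.Injective (σ a) :=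
  Function.LeftInverse.injective (h.inv_apply a)

/-- `σ a` as a permutation. -/
def perm (h : SK φ n σ) (a : B) : Equiv.Perm (ZMod n) :=
  ⟨σ a, σ a⁻¹, h.inv_apply a, h.apply_inv a⟩

theorem sub (h : SK φ n σ) (a : B) (x y : ZMod n) :
    σ a x - σ a y = σ ((φ ^ y.val) a) (x - y) := by
  have := h.add a (x - y) y
  rw [sub_add_cancel] at this
  rw [this]; ring

theorem neg (h : SK φ n σ) (a : B) (x : ZMod n) :
    σ a (-x) = - σ ((φ ^ x.val)⁻¹ a) x := by
  have := h.sub ((φ ^ x.val)⁻¹ a) 0 x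
  rw [h.zero, show (φ ^ x.val) ((φ ^ x.val)⁻¹ a) = a from Equiv.apply_symm_apply _ _,
    zero_sub, zero_sub] at this
  exact this.symm

/-- Invariant subset. -/
def Inv (_ : SK φ n σ) (S : Set (ZMod n)) : Prop := ∀ a, ∀ x ∈ S, σ a x ∈ S

theorem Inv.mem_iff {h : SK φ n σ} {S : Set (ZMod n)} (hS : h.Inv S) (a : B) (x : ZMod n) :
    σ a x ∈ S ↔ x ∈ S :=
  ⟨fun hx => by simpa [h.inv_apply] using hS a⁻¹ _ hx, hS a x⟩

theorem Inv.closure {h : SK φ n σ} {S : Set (ZMod n)} (hS : h.Inv S) :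
    h.Inv (AddSubgroup.closure S : Set (ZMod n)) := by
  intro a x hx
  have : ∀ a, σ a x ∈ AddSubgroup.closure S := by
    induction hx using AddSubgroup.closure_induction with
    | mem x hx => exact fun a => AddSubgroup.subset_closure (hS a x hx)
    | zero => intro a; rw [h.zero]; exact zero_mem _
    | add x y _ _ hx hy => intro a; rw [h.add]; exact add_mem (hx _) (hy _)
    | neg x _ hx => intro a; rw [h.neg]; exact neg_mem (hx _)
  exact this a

/-- claim A -/
theorem triv_quot [IsSimpleGroup B] (h : SK φ n σ) (D : AddSubgroup (ZMod n))
    (hD : h.Inv (D : Set (ZMod n))) (hb : D ≠ ⊥) (a : B) (x : ZMod n) : σ a x - x ∈ D := by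
  have key : ∀ a x d, d ∈ D → σ a (x + d) - σ a x ∈ D := by
    intro a x d hd
    rw [h.sub]; apply hD; simpa using hd
  let N : Subgroup B :=
    { carrier := {a | ∀ x, σ a x - x ∈ D}
      one_mem' := fun x => by simp [h.one]
      mul_mem' := fun {a b} ha hb x => by
        rw [h.mul]
        have := add_mem (hb (σ a x)) (ha x)
        simpa using this
      inv_mem' := fun {a} ha x => by
        have := neg_mem (ha (σ a⁻¹ x))
        simpa [h.apply_inv] using this }
  have hN : N.Normal := by
    refine ⟨fun a ha g x => ?_⟩
    rw [h.mul, h.mul]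
    have h1 := key g⁻¹ (σ g x) _ (ha (σ g x))
    rw [add_sub_cancel, h.inv_apply] at h1
    exact h1
  rcases hN.eq_bot_or_eq_top with e | e
  · exfalso
    apply hb
    rw [eq_bot_iff]
    intro d hd
    rw [AddSubgroup.mem_bot]
    apply h.pow_inj
    ext a
    simp only [ZMod.val_zero, pow_zero, Equiv.Perm.one_apply]
    have : (φ ^ d.val) a * a⁻¹ ∈ N := by
      intro x
      rw [h.mul]
      have h1 : σ ((φ ^ d.val) a) x - σ a x ∈ D := by
        have h2 := h.add a x d
        have h3 := sub_mem (key a x d hd) (hD a d hd)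
        rw [h2] at h3
        simpa [add_sub_right_comm] using h3
      have h4 := key a⁻¹ (σ a x) _ h1
      rw [h.inv_apply] at h4
      simpa using h4
    rw [e, Subgroup.mem_bot, mul_inv_eq_one] at this
    exact this
  · have : a ∈ N := by rw [e]; trivial
    exact this x

end SK


namespace SK

variable {B : Type*} [Group B] [Finite B] {φ : Equiv.Perm B} {n : ℕ} [NeZero n]
  {σ : B → ZMod n → ZMod n}

theorem conv_apply {R : Type*} [CommRing R] (F G : AddMonoidAlgebra R (ZMod n)) (z : ZMod n) :
    (F * G).coeff z = ∑ x, F.coeff x * G.coeff (z - x) := by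
  classical
  rw [AddMonoidAlgebra.coeff_mul, Finsupp.sum_fintype _ _ (by simp)]
  refine Finset.sum_congr rfl fun x _ => ?_
  rw [Finsupp.sum_fintype _ _ (by simp)]
  rw [Finset.sum_eq_single (z - x)]
  · simp
  · intro y _ hy
    rw [if_neg]
    intro e; apply hy; rw [← e]; ring
  · simp

theorem conv_inv {R : Type*} [CommRing R] (h : SK φ n σ) (F G : AddMonoidAlgebra R (ZMod n))
    (hF : ∀ a z, F.coeff (σ a z) = F.coeff z) (hG : ∀ a z, G.coeff (σ a z) = G.coeff z)
    (a : B) (z : ZMod n) :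
    (F * G).coeff (σ a z) = (F * G).coeff z := by
  rw [conv_apply, conv_apply, ← Equiv.sum_comp (h.perm a)]
  refine Finset.sum_congr rfl fun x _ => ?_
  change F.coeff (σ a x) * G.coeff (σ a z - σ a x) = _
  rw [hF, h.sub, hG]

theorem pow_inv {R : Type*} [CommRing R] (h : SK φ n σ) (F : AddMonoidAlgebra R (ZMod n))
    (hF : ∀ a z, F.coeff (σ a z) = F.coeff z) (k : ℕ) (a : B) (z : ZMod n) :
    (F ^ (k + 1)).coeff (σ a z) = (F ^ (k + 1)).coeff z := by
  induction k generalizing a z with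
  | zero => simpa using hF a z
  | succ k ih =>
    rw [pow_succ]
    exact h.conv_inv _ _ ih hF a z

theorem frob (h : SK φ n σ) (p : ℕ) [hp : Fact p.Prime] (T : Finset (ZMod n))
    (hT : h.Inv (T : Set (ZMod n))) (a : B) (z : ZMod n) :
    (((T.filter (fun t => p * t = σ a z)).card : ℕ) : ZMod p) =
      (((T.filter (fun t => p * t = z)).card : ℕ) : ZMod p) := by
  classical
  let F : AddMonoidAlgebra (ZMod p) (ZMod n) := ∑ t ∈ T, AddMonoidAlgebra.single t 1
  have hFa : ∀ z, F.coeff z = if z ∈ T then 1 else 0 := by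
    intro z
    simp [F, AddMonoidAlgebra.coeff_sum, Finsupp.finsetSum_apply, Finsupp.single_apply]
  have hFi : ∀ a z, F.coeff (σ a z) = F.coeff z := by
    intro a z
    rw [hFa, hFa]
    have := hT.mem_iff a z
    simp only [Finset.mem_coe] at this
    simp only [this]
  have hch : CharP (AddMonoidAlgebra (ZMod p) (ZMod n)) p :=
    charP_of_injective_algebraMap
      (algebraMap (ZMod p) (AddMonoidAlgebra (ZMod p) (ZMod n))).injective p
  have hex : ExpChar (AddMonoidAlgebra (ZMod p) (ZMod n)) p := ExpChar.prime hp.out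
  have hpow : F ^ p = ∑ t ∈ T, AddMonoidAlgebra.single (p * t) 1 := by
    simp only [F]
    rw [sum_pow_char p]
    refine Finset.sum_congr rfl fun t _ => ?_
    rw [AddMonoidAlgebra.single_pow]
    simp
  have hFp : ∀ z, (F ^ p).coeff z =
      (((T.filter (fun t => p * t = z)).card : ℕ) : ZMod p) := by
    intro z
    rw [hpow]
    simp [AddMonoidAlgebra.coeff_sum, Finsupp.finsetSum_apply, Finsupp.single_apply]
  rw [← hFp, ← hFp]
  have := h.pow_inv F hFi (p - 1) a z
  rwa [Nat.sub_add_cancel hp.out.one_le] at this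

/-- Orbit. -/
def orb (_ : SK φ n σ) (x : ZMod n) : Set (ZMod n) := Set.range fun a => σ a x

theorem orb_inv (h : SK φ n σ) (x : ZMod n) : h.Inv (h.orb x) := by
  rintro a _ ⟨b, rfl⟩
  exact ⟨b * a, h.mul b a x⟩

theorem mem_orb (h : SK φ n σ) (x : ZMod n) : x ∈ h.orb x := ⟨1, h.one x⟩

theorem orb_subset {h : SK φ n σ} {S : Set (ZMod n)} (hS : h.Inv S) {x : ZMod n} (hx : x ∈ S) :
    h.orb x ⊆ S := by
  rintro _ ⟨a, rfl⟩; exact hS a x hx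

theorem orb_eq (h : SK φ n σ) {x y : ZMod n} (hy : y ∈ h.orb x) : h.orb y = h.orb x := by
  apply Set.Subset.antisymm (orb_subset (h.orb_inv x) hy)
  apply orb_subset (h.orb_inv y)
  obtain ⟨a, rfl⟩ := hy
  exact ⟨a⁻¹, h.inv_apply a x⟩

theorem zero_notMem_orb (h : SK φ n σ) {x : ZMod n} (hx : x ≠ 0) : (0 : ZMod n) ∉ h.orb x := by
  rintro ⟨a, ha⟩
  apply hx
  apply h.inj a
  simpa [h.zero] using ha

/-- Stabilizer. -/
def stab (h : SK φ n σ) (x : ZMod n) : Subgroup B where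
  carrier := {a | σ a x = x}
  one_mem' := h.one x
  mul_mem' {a b} ha hb := by
    change σ (a * b) x = x
    rw [h.mul, ha, hb]
  inv_mem' {a} ha := by
    change σ a⁻¹ x = x
    conv_lhs => rw [← (show σ a x = x from ha)]
    exact h.inv_apply a x

theorem orb_ncard (h : SK φ n σ) (x : ZMod n) : (h.orb x).ncard = (h.stab x).index := by
  letI : MulAction B (ZMod n) :=
    { smul := fun a x => σ a⁻¹ x
      one_smul := fun x => by change σ 1⁻¹ x = x; rw [inv_one, h.one]
      mul_smul := fun a b x => by
        change σ (a * b)⁻¹ x = σ a⁻¹ (σ b⁻¹ x)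
        rw [mul_inv_rev, h.mul] }
  have h1 : h.orb x = MulAction.orbit B x := by
    ext y
    constructor
    · rintro ⟨a, rfl⟩
      exact ⟨a⁻¹, by change σ a⁻¹⁻¹ x = _; rw [inv_inv]⟩
    · rintro ⟨a, rfl⟩
      exact ⟨a⁻¹, rfl⟩
  have h2 : h.stab x = MulAction.stabilizer B x := by
    ext a
    rw [← inv_mem_iff]
    exact Iff.rfl
  rw [h1, h2, MulAction.index_stabilizer]

theorem orb_dvd (h : SK φ n σ) (x : ZMod n) : (h.orb x).ncard ∣ Nat.card B := by
  rw [h.orb_ncard]; exact Subgroup.index_dvd_card _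

/-- Primitivity -/
def Prim (h : SK φ n σ) : Prop :=
  ∀ D : AddSubgroup (ZMod n), h.Inv (D : Set (ZMod n)) → D = ⊥ ∨ D = ⊤

/-- Multipliers. -/
theorem mult (h : SK φ n σ) (k : ℕ) (hk : k.Coprime n) (T : Set (ZMod n)) (hT : h.Inv T) :
    h.Inv ((fun t => (k : ZMod n) * t) '' T) := by
  classical
  induction k using Nat.recOnMul generalizing T with
  | zero =>
    have : n = 1 := by simpa using hk
    subst this
    have : Subsingleton (ZMod 1) := inferInstanceAs (Subsingleton (Fin 1))
    intro a x hx
    rwa [Subsingleton.elim (σ a x) x]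
  | one => simpa using hT
  | prime p hp =>
    haveI := Fact.mk hp
    have hinj : Function.Injective (fun t : ZMod n => (p : ZMod n) * t) := by
      intro x y hxy
      exact (ZMod.isUnit_iff_coprime p n).2 hk |>.mul_left_cancel hxy
    rintro a _ ⟨t, ht, rfl⟩
    have := h.frob p T.toFinset (by simpa using hT) a (p * t)
    have h1 : T.toFinset.filter (fun s => (p : ZMod n) * s = p * t) = {t} := by
      ext s
      simp only [Finset.mem_filter, Set.mem_toFinset, Finset.mem_singleton]
      exact ⟨fun hs => hinj hs.2, fun hs => by subst hs; exact ⟨ht, rfl⟩⟩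
    rw [h1] at this
    by_contra hcon
    have h2 : T.toFinset.filter (fun s => (p : ZMod n) * s = σ a (p * t)) = ∅ := by
      ext s
      simp only [Finset.mem_filter, Set.mem_toFinset, Finset.notMem_empty, iff_false]
      rintro ⟨hs, e⟩
      exact hcon ⟨s, hs, e⟩
    rw [h2] at this
    simp at this
  | mul a b iha ihb =>
    have h1 := iha (Nat.Coprime.coprime_mul_right hk) _
      (ihb (Nat.Coprime.coprime_mul_left hk) T hT)
    rw [Set.image_image] at h1
    simpa [mul_assoc] using h1

end SK


namespace SK

variable {B : Type*} [Group B] [Finite B] {φ : Equiv.Perm B} {n : ℕ} [NeZero n]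
  {σ : B → ZMod n → ZMod n}

/-- The `p`-torsion of `ZMod n`. -/
def tors (n p : ℕ) : AddSubgroup (ZMod n) where
  carrier := {x | (p : ZMod n) * x = 0}
  zero_mem' := by simp
  add_mem' {x y} hx hy := by
    change (p : ZMod n) * (x + y) = 0
    rw [mul_add, show (p : ZMod n) * x = 0 from hx, show (p : ZMod n) * y = 0 from hy, add_zero]
  neg_mem' {x} hx := by
    change (p : ZMod n) * (-x) = 0
    rw [mul_neg, show (p : ZMod n) * x = 0 from hx, neg_zero]

theorem mem_tors {p : ℕ} {x : ZMod n} : x ∈ tors n p ↔ (p : ZMod n) * x = 0 := Iff.rfl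

theorem tors_card [DecidableEq (ZMod n)] {p : ℕ} (hp : 0 < p) :
    (Finset.univ.filter (fun x : ZMod n => (p : ZMod n) * x = 0)).card ≤ p := by
  have := IsAddCyclic.card_nsmul_eq_zero_le (α := ZMod n) hp
  simpa [nsmul_eq_mul] using this

theorem schur_aux (h : SK φ n σ) (hprim : h.Prim) (p : ℕ) (hp : p.Prime) (hpn : p ∣ n)
    (hne : p ≠ n) (x : ZMod n) (hx : x ≠ 0) : n - 1 < 2 * (h.orb x).ncard := by
  classical
  haveI := Fact.mk hp
  have hn1 : n ≠ 0 := NeZero.ne n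
  have hPtop : tors n p ≠ ⊤ := by
    intro e
    have : (1 : ZMod n) ∈ tors n p := by rw [e]; trivial
    rw [mem_tors, mul_one, ZMod.natCast_eq_zero_iff] at this
    exact hne (Nat.dvd_antisymm hpn this)
  have hPbot : tors n p ≠ ⊥ := by
    intro e
    obtain ⟨m, rfl⟩ := hpn
    have : (m : ZMod (p * m)) ∈ tors (p * m) p := by
      rw [mem_tors, ← Nat.cast_mul]; simp
    rw [e, AddSubgroup.mem_bot, ZMod.natCast_eq_zero_iff] at this
    have hm : 0 < m := Nat.pos_of_ne_zero (by rintro rfl; simp at hn1)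
    have := Nat.le_of_dvd hm this
    have := hp.two_le
    nlinarith
  have coset : ∀ y : ZMod n, y ≠ 0 → ∀ t ∈ h.orb y, t ∉ tors n p →
      ((h.orb y).toFinset.filter (fun s => (p : ZMod n) * s = p * t)).card = p ∧
      ∀ d ∈ tors n p, t + d ∈ h.orb y := by
    intro y hy t ht htP
    set T := (h.orb y).toFinset with hT
    let S : Set (ZMod n) := {z | ((T.filter (fun s => (p : ZMod n) * s = z)).card : ZMod p) ≠ 0}
    have hS : h.Inv S := by
      intro a z hz
      change ((T.filter (fun s => (p : ZMod n) * s = σ a z)).card : ZMod p) ≠ 0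
      rw [h.frob p T (by simpa [hT] using h.orb_inv y)]
      exact hz
    have hcl := hprim _ hS.closure
    let R : AddSubgroup (ZMod n) := (AddMonoidHom.mulLeft (p : ZMod n)).range
    have hRS : AddSubgroup.closure S ≤ R := by
      rw [AddSubgroup.closure_le]
      intro z hz
      by_contra hcon
      apply hz
      rw [Finset.filter_false_of_mem, Finset.card_empty, Nat.cast_zero]
      intro s _ e
      exact hcon ⟨s, e⟩
    have hR : R ≠ ⊤ := by
      intro e
      have : (1 : ZMod n) ∈ R := by rw [e]; trivial
      obtain ⟨s, hs⟩ := this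
      have hu : IsUnit (p : ZMod n) := IsUnit.of_mul_eq_one s hs
      rw [ZMod.isUnit_iff_coprime] at hu
      have := Nat.Coprime.eq_one_of_dvd hu hpn
      exact hp.one_lt.ne' this
    have hbot : AddSubgroup.closure S = ⊥ := by
      rcases hcl with e | e
      · exact e
      · exact absurd (top_le_iff.1 (e ▸ hRS)) hR
    have hnot : (p : ZMod n) * t ∉ S := by
      intro hmem
      have := AddSubgroup.subset_closure hmem
      rw [hbot] at this
      exact htP this
    have hdvd : p ∣ (T.filter (fun s => (p : ZMod n) * s = p * t)).card := by
      rw [← ZMod.natCast_eq_zero_iff]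
      by_contra hcon
      exact hnot hcon
    have hpos : 0 < (T.filter (fun s => (p : ZMod n) * s = p * t)).card :=
      Finset.card_pos.2 ⟨t, by simp [hT, ht]⟩
    have hle := Nat.le_of_dvd hpos hdvd
    let Q := (Finset.univ.filter (fun x : ZMod n => (p : ZMod n) * x = 0)).image (fun d => t + d)
    have hQ : Q.card ≤ p := Finset.card_image_le.trans (tors_card hp.pos)
    have hsub : T.filter (fun s => (p : ZMod n) * s = p * t) ⊆ Q := by
      intro s hs
      rw [Finset.mem_filter] at hs
      refine Finset.mem_image.2 ⟨s - t, ?_, by ring⟩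
      simp [mul_sub, hs.2]
    have heq := Finset.eq_of_subset_of_card_le hsub (hQ.trans hle)
    refine ⟨le_antisymm ((Finset.card_le_card hsub).trans hQ) hle, fun d hd => ?_⟩
    have : t + d ∈ Q := Finset.mem_image.2 ⟨d, by simpa [mem_tors] using hd, rfl⟩
    rw [← heq] at this
    simpa [hT] using (Finset.mem_filter.1 this).1
  have meets : ∀ y : ZMod n, y ≠ 0 → ∃ t ∈ h.orb y, t ∈ tors n p := by
    intro y hy
    by_contra! hcon
    let Q : AddSubgroup (ZMod n) :=
      { carrier := {d | ∀ t, t + d ∈ h.orb y ↔ t ∈ h.orb y}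
        zero_mem' := by simp
        add_mem' := fun {a b} ha hb t => by rw [← add_assoc, hb, ha]
        neg_mem' := fun {a} ha t => by
          have := ha (t + -a)
          rw [neg_add_cancel_right] at this
          exact this.symm }
    have hQ : h.Inv (Q : Set (ZMod n)) := by
      intro a d hd t
      have e : t = σ ((φ ^ d.val) a) (σ ((φ ^ d.val) a)⁻¹ t) := (h.apply_inv _ _).symm
      conv_lhs => rw [e, ← h.add]
      rw [(h.orb_inv y).mem_iff, hd, (h.orb_inv y).mem_iff]
    have hPQ : tors n p ≤ Q := by
      intro d hd t
      constructor
      · intro ht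
        have := (coset y hy _ ht (hcon _ ht)).2 (-d) (neg_mem hd)
        simpa using this
      · intro ht
        exact (coset y hy _ ht (hcon _ ht)).2 d hd
    rcases hprim Q hQ with e | e
    · rw [e, le_bot_iff] at hPQ
      exact hPbot hPQ
    · have : y ∈ Q := by rw [e]; trivial
      have := (this 0).1 (by rw [zero_add]; exact h.mem_orb y)
      exact h.zero_notMem_orb hy this
  set T := (h.orb x).toFinset with hT
  have hTc : (h.orb x).ncard = T.card := by rw [Set.ncard_eq_toFinset_card']
  have memT : ∀ z, z ∈ T ↔ z ∈ h.orb x := fun z => by simp [hT]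
  let W := T.filter (fun t => t ∉ tors n p)
  let U := T.filter (fun t => t ∈ tors n p)
  have hUW : U.card + W.card = T.card := Finset.card_filter_add_card_filter_not _
  have hU : U.card + 1 ≤ p := by
    have : insert 0 U ⊆ Finset.univ.filter (fun x : ZMod n => (p : ZMod n) * x = 0) := by
      intro z hz
      rw [Finset.mem_insert] at hz
      rcases hz with rfl | hz
      · simp
      · simpa [mem_tors] using (Finset.mem_filter.1 hz).2
    have h2 := (Finset.card_le_card this).trans (tors_card hp.pos)
    rwa [Finset.card_insert_of_notMem] at h2
    intro h0
    exact h.zero_notMem_orb hx ((memT _).1 (Finset.mem_filter.1 h0).1)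
  have hWp : p ≤ W.card := by
    have : ∃ t ∈ h.orb x, t ∉ tors n p := by
      by_contra! hcon
      have hle : AddSubgroup.closure (h.orb x) ≤ tors n p := by
        rw [AddSubgroup.closure_le]; exact hcon
      rcases hprim _ (h.orb_inv x).closure with e | e
      · have := AddSubgroup.subset_closure (h.mem_orb x)
        rw [e] at this
        exact hx this
      · rw [e, top_le_iff] at hle
        exact hPtop hle
    obtain ⟨t, ht, htP⟩ := this
    rw [← (coset x hx t ht htP).1]
    apply Finset.card_le_card
    intro s hs
    rw [Finset.mem_filter] at hs ⊢
    refine ⟨hs.1, ?_⟩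
    rw [mem_tors, hs.2]
    exact htP
  let g : ZMod n → ℕ := fun z => (T.filter (fun t => z + t ∈ T)).card
  have hg : ∀ a z, g z ≤ g (σ a z) := by
    intro a z
    apply Finset.card_le_card_of_injOn (fun t => σ a (z + t) - σ a z)
    · intro t ht
      simp only [Finset.coe_filter, Set.mem_ofPred_eq, memT] at ht ⊢
      refine ⟨?_, ?_⟩
      · rw [h.sub, (h.orb_inv x).mem_iff]; simpa using ht.1
      · rw [add_sub_cancel, (h.orb_inv x).mem_iff]; exact ht.2
    · intro t _ t' _ e
      have := h.inj a (sub_left_injective e)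
      exact add_left_cancel this
  have hgW : ∀ z, z ≠ 0 → W.card ≤ g z := by
    intro z hz
    obtain ⟨t, ⟨a, rfl⟩, ht⟩ := meets z hz
    have h1 := hg a⁻¹ (σ a z)
    rw [h.inv_apply] at h1
    refine le_trans ?_ h1
    apply Finset.card_le_card
    intro s hs
    rw [Finset.mem_filter] at hs ⊢
    refine ⟨hs.1, ?_⟩
    rw [memT, add_comm]
    exact (coset x hx s ((memT _).1 hs.1) hs.2).2 _ ht
  have hsum : ∑ z, g z = T.card * T.card := by
    have : ∀ z, g z = ∑ t ∈ T, if z + t ∈ T then 1 else 0 := by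
      intro z; simp [g]
    simp only [this]
    rw [Finset.sum_comm]
    have h2 : ∀ t ∈ T, (∑ z, if z + t ∈ T then 1 else 0) = T.card := by
      intro t _
      have h3 := Equiv.sum_comp (Equiv.addRight t) (fun z => if z ∈ T then 1 else 0)
      simp only [Equiv.coe_addRight] at h3
      refine Eq.trans ?_ (h3.trans ?_)
      · rfl
      · simp
    rw [Finset.sum_congr rfl h2]
    simp
  have hg0 : g 0 = T.card := by simp [g]
  rw [← Finset.add_sum_erase _ _ (Finset.mem_univ (0 : ZMod n)), hg0] at hsum
  have hlow : (n - 1) * W.card ≤ ∑ z ∈ Finset.univ.erase (0 : ZMod n), g z := by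
    have := Finset.card_nsmul_le_sum (Finset.univ.erase (0 : ZMod n)) g W.card
      (fun z hz => hgW z (Finset.ne_of_mem_erase hz))
    rw [Finset.card_erase_of_mem (Finset.mem_univ _), Finset.card_univ, ZMod.card] at this
    simpa using this
  rw [hTc]
  by_contra! hcon
  have h5 : 2 * T.card * W.card ≤ (n - 1) * W.card := Nat.mul_le_mul_right _ hcon
  have h6 : T.card * (1 + 2 * W.card) ≤ T.card * T.card := by nlinarith
  have h7 : 0 < T.card := by omega
  have h8 := Nat.le_of_mul_le_mul_left h6 h7
  omega

theorem schur (h : SK φ n σ) (hprim : h.Prim) (p : ℕ) (hp : p.Prime) (hpn : p ∣ n)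
    (hne : p ≠ n) (x : ZMod n) (hx : x ≠ 0) : h.orb x = {0}ᶜ := by
  apply Set.Subset.antisymm
  · intro y hy e
    rw [Set.mem_singleton_iff] at e
    subst e
    exact h.zero_notMem_orb hx hy
  · intro y hy
    by_contra hcon
    have h1 := h.schur_aux hprim p hp hpn hne x hx
    have h2 := h.schur_aux hprim p hp hpn hne y hy
    have hd : Disjoint (h.orb x) (h.orb y) := by
      rw [Set.disjoint_left]
      intro z hz hz'
      apply hcon
      rw [← h.orb_eq hz, h.orb_eq hz']
      exact h.mem_orb y
    have h3 := Set.ncard_union_eq hd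
    have h4 : h.orb x ∪ h.orb y ⊆ ({0}ᶜ : Set (ZMod n)) := by
      rintro z (hz | hz) e <;> rw [Set.mem_singleton_iff] at e <;> subst e
      · exact h.zero_notMem_orb hx hz
      · exact h.zero_notMem_orb hy hz
    have h5 := Set.ncard_le_ncard h4
    rw [Set.ncard_compl, Nat.card_zmod, Set.ncard_singleton] at h5
    omega

end SK


/-- The group-theoretic properties of `Alt(5)` used for the order computation. -/
structure GoodGroup (B : Type*) [Group B] : Prop where
  simple : IsSimpleGroup B
  card : Nat.card B = 60
  nc : ∃ a b : B, a * b ≠ b * a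

theorem GoodGroup.hom_triv {B : Type*} [Group B] (hB : GoodGroup B) {M : Type*} [CommGroup M]
    (f : B →* M) (a : B) : f a = 1 := by
  have := hB.simple
  rcases (inferInstance : f.ker.Normal).eq_bot_or_eq_top with e | e
  · exfalso
    obtain ⟨x, y, hxy⟩ := hB.nc
    apply hxy
    apply (MonoidHom.ker_eq_bot_iff f).1 e
    rw [map_mul, map_mul, mul_comm]
  · have : a ∈ f.ker := by rw [e]; trivial
    exact this

theorem GoodGroup.finite {B : Type*} [Group B] (hB : GoodGroup B) : Finite B :=
  Nat.finite_of_card_ne_zero (by rw [hB.card]; norm_num)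

theorem GoodGroup.index_ge {B : Type*} [Group B] (hB : GoodGroup B) (S : Subgroup B)
    (hS : S ≠ ⊤) : 5 ≤ S.index := by
  have := hB.simple
  have := hB.finite
  by_contra! hlt
  rcases (inferInstance : S.normalCore.Normal).eq_bot_or_eq_top with e | e
  · rw [Subgroup.normalCore_eq_ker, MonoidHom.ker_eq_bot_iff] at e
    have h1 := Nat.card_le_card_of_injective _ e
    rw [hB.card, Nat.card_perm] at h1
    have h2 : Nat.card (B ⧸ S) ≤ 4 := by
      change S.index ≤ 4
      omega
    have := Nat.factorial_le h2
    have h4 : Nat.factorial 4 = 24 := rfl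
    omega
  · apply hS
    rw [eq_top_iff, ← e]
    exact S.normalCore_le

namespace SK

variable {B : Type*} [Group B] [Finite B] {φ : Equiv.Perm B} {n : ℕ} [NeZero n]
  {σ : B → ZMod n → ZMod n}

theorem pow_one' (h : SK φ n σ) : φ ^ (1 : ZMod n).val = φ := by
  have := h.pow_natCast 1
  simpa using this

theorem skew_of (h : SK φ n σ) : Skew φ := by
  refine ⟨h.map_one, fun a => ⟨(σ a 1).val, fun b => ?_⟩⟩
  have := h.rel a 1 b
  rwa [h.pow_one'] at this

theorem proper_iff (h : SK φ n σ) : PSkew φ ↔ ∃ a, σ a 1 ≠ 1 := by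
  constructor
  · intro hp
    by_contra! hcon
    apply hp.2
    intro a b
    have := h.rel a 1 b
    rwa [hcon, h.pow_one'] at this
  · rintro ⟨a, ha⟩
    refine ⟨h.skew_of, fun hcon => ha ?_⟩
    apply h.pow_inj
    ext b
    have := h.rel a 1 b
    rw [h.pow_one', hcon] at this
    rw [h.pow_one']
    exact (mul_left_cancel this).symm

theorem fixed_mul (h : SK φ n σ) (e : ZMod n) (he : ∀ a, σ a e = e) (k : ℕ) :
    ∀ a, σ a (k * e) = k * e := by
  induction k with
  | zero => intro a; simp [h.zero]
  | succ k ih =>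
    intro a
    rw [Nat.cast_add, Nat.cast_one, add_mul, one_mul, h.add, ih, he]

theorem not_all_fixed (h : SK φ n σ) (hp : PSkew φ) : ∃ a, σ a 1 ≠ 1 := h.proper_iff.1 hp

theorem faithful (h : SK φ n σ) (hB : GoodGroup B) (hp : PSkew φ) (a : B)
    (ha : ∀ x, σ a x = x) : a = 1 := by
  have := hB.simple
  let N : Subgroup B :=
    { carrier := {a | ∀ x, σ a x = x}
      one_mem' := h.one
      mul_mem' := fun {a b} ha hb x => by rw [h.mul, ha, hb]
      inv_mem' := fun {a} ha x => by
        conv_lhs => rw [← ha x]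
        exact h.inv_apply a x }
  have hN : N.Normal := by
    refine ⟨fun a ha g x => ?_⟩
    rw [h.mul, h.mul, ha, h.inv_apply]
  rcases hN.eq_bot_or_eq_top with e | e
  · have : a ∈ N := ha
    rw [e] at this
    exact this
  · obtain ⟨b, hb⟩ := h.not_all_fixed hp
    exfalso
    apply hb
    have : b ∈ N := by rw [e]; trivial
    exact this 1

theorem inj_left (h : SK φ n σ) (hB : GoodGroup B) (hp : PSkew φ) (a b : B)
    (hab : ∀ x, σ a x = σ b x) : a = b := by
  have := h.faithful hB hp (a * b⁻¹) (fun x => by rw [h.mul, hab, h.inv_apply])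
  exact mul_inv_eq_one.1 this

theorem orb_ge (h : SK φ n σ) (hB : GoodGroup B) (x : ZMod n) (hx : ∃ a, σ a x ≠ x) :
    5 ≤ (h.orb x).ncard := by
  rw [h.orb_ncard]
  apply hB.index_ge
  intro e
  obtain ⟨a, ha⟩ := hx
  apply ha
  have : a ∈ h.stab x := by rw [e]; trivial
  exact this

theorem ge_six (h : SK φ n σ) (hB : GoodGroup B) (hp : PSkew φ) : 6 ≤ n := by
  have h1 := h.not_all_fixed hp
  have h2 := h.orb_ge hB 1 h1
  have h10 : (1 : ZMod n) ≠ 0 := by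
    intro e
    obtain ⟨a, ha⟩ := h1
    apply ha
    have : ∀ x : ZMod n, x = 0 := fun x => by rw [← mul_one x, e, mul_zero]
    rw [this (σ a 1), this 1]
  have h3 : h.orb 1 ⊆ ({0}ᶜ : Set (ZMod n)) := by
    intro y hy e
    rw [Set.mem_singleton_iff] at e
    subst e
    exact h.zero_notMem_orb h10 hy
  have h5 := Set.ncard_le_ncard h3
  rw [Set.ncard_compl, Nat.card_zmod, Set.ncard_singleton] at h5
  omega

/-- Fixed points of `φ ^ j`. -/
def fixS (h : SK φ n σ) (j : ZMod n)
    (hj : ∀ a, (φ ^ j.val) a = a → ∃ k : ℕ, σ a j = k * j) : Subgroup B :=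
  have key : ∀ {a b : B}, (φ ^ j.val) a = a → (φ ^ j.val) b = b → (φ ^ j.val) (a * b) = a * b := by
    intro a b ha hb
    obtain ⟨k, hk⟩ := hj a ha
    rw [h.rel, hk, ha]
    have : ((k : ZMod n) * j) = ((k * j.val : ℕ) : ZMod n) := by simp
    rw [this, h.pow_natCast, mul_comm k, pow_mul]
    congr 1
    exact Function.IsFixedPt.perm_pow (e := φ ^ j.val) hb k
  { carrier := {a | (φ ^ j.val) a = a}
    one_mem' := h.fix_one j
    mul_mem' := fun ha hb => key ha hb
    inv_mem' := fun {a} ha => by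
      have h1 : ∀ m : ℕ, (φ ^ j.val) (a ^ m) = a ^ m := by
        intro m
        induction m with
        | zero => rw [pow_zero]; exact h.fix_one j
        | succ m ih => rw [pow_succ]; exact key ih ha
      have h2 : a⁻¹ = a ^ (orderOf a - 1) := by
        apply inv_eq_of_mul_eq_one_right
        rw [← pow_succ', Nat.sub_add_cancel (orderOf_pos a), pow_orderOf_eq_one]
      change (φ ^ j.val) a⁻¹ = a⁻¹
      rw [h2, h1] }

theorem mem_fixS (h : SK φ n σ) (j : ZMod n)
    (hj : ∀ a, (φ ^ j.val) a = a → ∃ k : ℕ, σ a j = k * j) (a : B) :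
    a ∈ h.fixS j hj ↔ (φ ^ j.val) a = a := Iff.rfl

theorem fixS_card (h : SK φ n σ) (j : ZMod n)
    (hj : ∀ a, (φ ^ j.val) a = a → ∃ k : ℕ, σ a j = k * j) (p : ℕ) [Fact p.Prime]
    (hpj : (p : ZMod n) * j = 0) : Nat.card B ≡ Nat.card (h.fixS j hj) [MOD p] := by
  classical
  have := Fintype.ofFinite B
  have h1 : (φ ^ j.val) ^ p ^ 1 = 1 := by
    rw [pow_one, ← pow_mul, ← h.pow_natCast]
    have : ((j.val * p : ℕ) : ZMod n) = 0 := by rw [← hpj]; simp [mul_comm]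
    rw [this]; simp
  let f : Function.End B := ⇑(φ ^ j.val)
  have h0 : ∀ m : ℕ, f ^ m = (show Function.End B from ⇑((φ ^ j.val) ^ m)) := by
    intro m
    induction m with
    | zero => rfl
    | succ m ih => rw [pow_succ, ih, pow_succ]; rfl
  have h1' : f ^ p ^ 1 = 1 := by
    rw [h0, h1]; rfl
  have h2 := Equiv.Perm.card_fixedPoints_modEq h1'
  rw [← Nat.card_eq_fintype_card, ← Nat.card_eq_fintype_card] at h2
  exact h2

theorem fixS_ne (h : SK φ n σ) (j : ZMod n)
    (hj : ∀ a, (φ ^ j.val) a = a → ∃ k : ℕ, σ a j = k * j) (hj0 : j ≠ 0) : h.fixS j hj ≠ ⊤ := by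
  intro e
  apply hj0
  apply h.pow_inj
  ext a
  have : a ∈ h.fixS j hj := by rw [e]; trivial
  simpa using (h.mem_fixS j hj a).1 this

theorem fix_lin (h : SK φ n σ) (j : ZMod n) (a : B) (ha : (φ ^ j.val) a = a) (k : ℕ) :
    σ a (k * j) = k * σ a j := by
  induction k with
  | zero => simp [h.zero]
  | succ k ih =>
    rw [Nat.cast_add, Nat.cast_one, add_mul, one_mul, h.add, ha, ih]
    ring

theorem seven (h : SK φ n σ) (hB : GoodGroup B) (j : ZMod n) (hj7 : 7 * j = 0) (hj0 : j ≠ 0)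
    (hd1 : ∀ y : ZMod n, 7 * y = 0 → ∃ k : ℕ, y = k * j)
    (hd2 : ∀ x : ZMod n, x ^ 4 * j = j → x * j = j ∨ x * j = -j) :
    ∃ a : B, a ≠ 1 ∧ a ^ 4 = 1 ∧ (φ ^ j.val) a = a ∧ σ a j = j := by
  classical
  have hj : ∀ a, (φ ^ j.val) a = a → ∃ k : ℕ, σ a j = k * j := by
    intro a ha
    apply hd1
    have := h.fix_lin j a ha 7
    rw [← Nat.cast_ofNat (n := 7), ← this, Nat.cast_ofNat, hj7, h.zero]
  have : Fact (Nat.Prime 7) := ⟨by norm_num⟩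
  have h1 := h.fixS_card j hj 7 (by simpa using hj7)
  have h2 := h.fixS_ne j hj hj0
  set F := h.fixS j hj with hF
  have h3 : Nat.card F ∣ 60 := by rw [← hB.card]; exact Subgroup.card_subgroup_dvd_card F
  have h4 : Nat.card F ≠ 60 := by
    intro e
    apply h2
    apply Subgroup.eq_top_of_card_eq
    rw [e, hB.card]
  have h5 : Nat.card F = 4 := by
    rw [hB.card] at h1
    have h6 : Nat.card F ∈ Nat.divisors 60 := by simp [h3]
    generalize Nat.card F = m at *
    have : ∀ m ∈ Nat.divisors 60, m ≠ 60 → 60 ≡ m [MOD 7] → m = 4 := by decide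
    exact this m h6 h4 h1
  have hpow : ∀ a ∈ F, a ^ 4 = 1 := by
    intro a ha
    have h6 : (⟨a, ha⟩ : F) ^ 4 = 1 := by rw [← h5]; exact pow_card_eq_one'
    exact congrArg Subtype.val h6
  have hval : ∀ a ∈ F, σ a j = j ∨ σ a j = -j := by
    intro a ha
    obtain ⟨k, hk⟩ := hj a ha
    rw [hk]
    apply hd2
    have e1 : ∀ m : ℕ, σ a (m * j) = m * k * j := by
      intro m; rw [h.fix_lin j a ha, hk, mul_assoc]
    have e2 : σ (a ^ 4) j = k ^ 4 * j := by
      rw [pow_succ, pow_succ, pow_two, h.mul, h.mul, h.mul, hk, e1]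
      have := e1 (k * k)
      push_cast at this
      rw [this]
      have := e1 (k * k * k)
      push_cast at this
      rw [this]
      ring
    rw [← e2, hpow a ha, h.one]
  have := Fintype.ofFinite F
  have hpig : ∃ a b : F, a ≠ b ∧ σ (a : B) j = σ (b : B) j := by
    obtain ⟨a, _, b, _, hab, e⟩ := Finset.exists_ne_map_eq_of_card_lt_of_maps_to
      (s := (Finset.univ : Finset F)) (t := ({j, -j} : Finset (ZMod n)))
      (f := fun a => σ (a : B) j) (by
        rw [Finset.card_univ, ← Nat.card_eq_fintype_card, h5]
        exact lt_of_le_of_lt Finset.card_le_two (by norm_num))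
      (by
        intro a _
        have := hval a a.2
        simpa using this)
    exact ⟨a, b, hab, e⟩
  obtain ⟨a, b, hab, e⟩ := hpig
  refine ⟨(a * b⁻¹ : F), ?_, hpow _ (a * b⁻¹ : F).2, (a * b⁻¹ : F).2, ?_⟩
  · intro e
    apply hab
    have : a * b⁻¹ = 1 := by exact_mod_cast e
    exact mul_inv_eq_one.1 this
  · push_cast
    rw [h.mul, e, h.inv_apply]

end SK

theorem no_seven {B : Type*} [Group B] [Finite B] {φ : Equiv.Perm B}
    {σ : B → ZMod 7 → ZMod 7} (h : SK φ 7 σ) (hB : GoodGroup B) (hp : PSkew φ) : False := by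
  obtain ⟨a, ha1, ha4, haf, ha⟩ := h.seven hB 1 (by decide) (by decide)
    (fun y _ => ⟨y.val, by simp⟩) (by decide)
  apply ha1
  apply h.faithful hB hp
  intro x
  have := h.fix_lin 1 a haf x.val
  simpa [ha] using this

theorem no_21 {B : Type*} [Group B] [Finite B] {φ : Equiv.Perm B}
    {σ : B → ZMod 21 → ZMod 21} (h : SK φ 21 σ) (hB : GoodGroup B) (hp : PSkew φ)
    (hprim : h.Prim) : False := by
  obtain ⟨a, ha1, ha4, haf, ha⟩ := h.seven hB 3 (by decide) (by decide)
    (fun y hy => by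
      have : ∀ y : ZMod 21, 7 * y = 0 → ∃ k : Fin 7, y = (k.val : ZMod 21) * 3 := by decide
      obtain ⟨k, hk⟩ := this y hy
      exact ⟨k, hk⟩) (by decide)
  have h1 := h.schur hprim 3 (by norm_num) (by norm_num) (by norm_num) 3 (by decide)
  have h2 := h.orb_ncard 3
  rw [h1, Set.ncard_compl, Nat.card_zmod, Set.ncard_singleton] at h2
  have h3 := (h.stab 3).card_mul_index
  rw [← h2, hB.card] at h3
  have h4 : Nat.card (h.stab 3) = 3 := by omega
  have h5 : (⟨a, ha⟩ : h.stab 3) ^ 3 = 1 := by rw [← h4]; exact pow_card_eq_one'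
  have h6 : a ^ 3 = 1 := congrArg Subtype.val h5
  apply ha1
  rw [pow_succ, h6, one_mul] at ha4
  exact ha4

theorem prime_mult {B : Type*} [Group B] [Finite B] {φ : Equiv.Perm B} {n : ℕ} [hn : Fact n.Prime]
    {σ : B → ZMod n → ZMod n} (h : SK φ n σ) :
    (h.orb 1).ncard ∣ n - 1 ∧ ∀ a z, (σ a z) ^ (h.orb 1).ncard = z ^ (h.orb 1).ncard := by
  classical
  set T := h.orb 1 with hT
  have hcop : ∀ z : ZMod n, z ≠ 0 → z.val.Coprime n := by
    intro z hz
    have := (ZMod.isUnit_iff_coprime z.val n).1 (by simpa using hz)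
    exact this
  have hz : ∀ z : ZMod n, z ≠ 0 → h.Inv ((fun t => z * t) '' T) := by
    intro z hz
    have := h.mult z.val (hcop z hz) T (h.orb_inv 1)
    simpa using this
  have h1T : (1 : ZMod n) ∈ T := h.mem_orb 1
  have h0T : (0 : ZMod n) ∉ T := h.zero_notMem_orb one_ne_zero
  have horb : ∀ z a, z ≠ 0 → ∃ t ∈ T, z * t = σ a z := by
    intro z a h0
    have := hz z h0 a z ⟨1, h1T, mul_one z⟩
    exact this
  have hmul : ∀ x y, x ∈ T → y ∈ T → x * y ∈ T := by
    intro x y hx hy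
    have hx0 : x ≠ 0 := fun e => h0T (e ▸ hx)
    have hsub : T ⊆ (fun t => x * t) '' T := by
      conv_lhs => rw [hT, ← h.orb_eq hx]
      exact SK.orb_subset (hz x hx0) ⟨1, h1T, mul_one x⟩
    have heq : T = (fun t => x * t) '' T :=
      Set.eq_of_subset_of_ncard_le hsub (Set.ncard_image_le (Set.toFinite T)) (Set.toFinite _)
    rw [heq]
    exact ⟨y, hy, rfl⟩
  let U : Subgroup (ZMod n)ˣ :=
    { carrier := {u | (u : ZMod n) ∈ T}
      one_mem' := by simpa using h1T
      mul_mem' := fun {a b} ha hb => by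
        change ((a * b : (ZMod n)ˣ) : ZMod n) ∈ T
        rw [Units.val_mul]; exact hmul _ _ ha hb
      inv_mem' := fun {a} ha => by
        have h1 : ∀ m : ℕ, ((a ^ m : (ZMod n)ˣ) : ZMod n) ∈ T := by
          intro m
          induction m with
          | zero => simpa using h1T
          | succ m ih => rw [pow_succ, Units.val_mul]; exact hmul _ _ ih ha
        have h2 : a⁻¹ = a ^ (orderOf a - 1) := by
          apply inv_eq_of_mul_eq_one_right
          rw [← pow_succ', Nat.sub_add_cancel (orderOf_pos a), pow_orderOf_eq_one]
        change ((a⁻¹ : (ZMod n)ˣ) : ZMod n) ∈ T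
        rw [h2]; exact h1 _ }
  have hcard : Nat.card U = T.ncard := by
    rw [← Nat.card_coe_set_eq]
    refine Nat.card_congr (Equiv.ofBijective (fun u => ⟨(u.1 : ZMod n), u.2⟩) ⟨?_, ?_⟩)
    · intro u v e
      have := congrArg Subtype.val e
      exact Subtype.ext (Units.ext this)
    · rintro ⟨t, ht⟩
      have h0 : t ≠ 0 := fun e => h0T (e ▸ ht)
      exact ⟨⟨Units.mk0 t h0, ht⟩, rfl⟩
  have hpow : ∀ t ∈ T, t ^ T.ncard = 1 := by
    intro t ht
    have h0 : t ≠ 0 := fun e => h0T (e ▸ ht)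
    have h1 : (⟨Units.mk0 t h0, ht⟩ : U) ^ T.ncard = 1 := by rw [← hcard]; exact pow_card_eq_one'
    have h2 := congrArg (fun u : U => ((u : (ZMod n)ˣ) : ZMod n)) h1
    simpa using h2
  constructor
  · rw [← hcard]
    have := Subgroup.card_subgroup_dvd_card U
    rwa [Nat.card_eq_fintype_card (α := (ZMod n)ˣ), ZMod.card_units] at this
  · intro a z
    by_cases h0 : z = 0
    · rw [h0, h.zero]
    · obtain ⟨t, ht, e⟩ := horb z a h0
      rw [← e, mul_pow, hpow t ht, mul_one]

theorem no_19 {B : Type*} [Group B] [Finite B] {φ : Equiv.Perm B}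
    {σ : B → ZMod 19 → ZMod 19} (h : SK φ 19 σ) (hB : GoodGroup B) (hp : PSkew φ)
    (h6 : ∀ a z, (σ a z) ^ 6 = z ^ 6) : False := by
  have hdec : ∀ x y : ZMod 19, x ^ 6 = 1 → y ^ 6 = 1 → (x + y) ^ 6 = 2 ^ 6 → x = y := by decide
  have h1 : ∀ a, σ (φ a) 1 = σ a 1 := by
    intro a
    have e := h.add a 1 1
    rw [h.pow_one'] at e
    apply hdec
    · rw [h6, one_pow]
    · rw [h6, one_pow]
    · rw [← e, h6]; decide
  have h2 : ∀ (k : ℕ) (a : B), σ a k = k * σ a 1 := by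
    intro k
    induction k with
    | zero => intro a; simp [h.zero]
    | succ k ih =>
      intro a
      push_cast
      rw [h.add, h.pow_one', ih, h1]
      ring
  have h3 : ∀ (x : ZMod 19) (a : B), σ a x = x * σ a 1 := by
    intro x a
    have := h2 x.val a
    simpa using this
  have hinj : Function.Injective (fun a : B => σ a 1) := by
    intro a b e
    apply h.inj_left hB hp
    intro x
    rw [h3, h3 x b, show σ a 1 = σ b 1 from e]
  have := Nat.card_le_card_of_injective _ hinj
  rw [hB.card, Nat.card_zmod] at this
  omega

theorem prime_case {B : Type*} [Group B] [Finite B] {φ : Equiv.Perm B} {n : ℕ} (hn : n.Prime)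
    {σ : B → ZMod n → ZMod n} (h : SK φ n σ) (hB : GoodGroup B) (hp : PSkew φ) : n = 11 := by
  have : Fact n.Prime := ⟨hn⟩
  have h6 := h.ge_six hB hp
  have hj : ∀ a, (φ ^ (1 : ZMod n).val) a = a → ∃ k : ℕ, σ a 1 = k * 1 :=
    fun a _ => ⟨(σ a 1).val, by simp⟩
  have h1 := h.fixS_card 1 hj n (by simp)
  have h2 := h.fixS_ne 1 hj one_ne_zero
  set F := h.fixS 1 hj with hF
  have h3 : Nat.card F ∣ 60 := by rw [← hB.card]; exact Subgroup.card_subgroup_dvd_card F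
  have h4 : Nat.card F ≠ 60 := by
    intro e
    apply h2
    apply Subgroup.eq_top_of_card_eq
    rw [e, hB.card]
  rw [hB.card] at h1
  have h5 : Nat.card F ∈ Nat.divisors 60 := by simp [h3]
  have h7 : n = 59 ∨ n = 29 ∨ n = 19 ∨ n = 7 ∨ n = 11 := by
    generalize Nat.card F = m at *
    have hle : m ≤ 60 := Nat.le_of_dvd (by norm_num) h3
    have hd : n ∣ 60 - m := (Nat.modEq_iff_dvd' hle).1 h1.symm
    have hlt : n < 60 := lt_of_le_of_lt (Nat.le_of_dvd (by omega) hd) (by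
      have := Nat.pos_of_mem_divisors h5; omega)
    have key : ∀ m ∈ Nat.divisors 60, m ≠ 60 → ∀ n ∈ Finset.range 60, 6 ≤ n → n ∣ 60 - m →
      (n = 59 ∨ n = 29 ∨ n = 19 ∨ n = 7 ∨ n = 11) ∨ (∃ d ∈ Finset.range n, 2 ≤ d ∧ d ∣ n) := by decide +kernel
    rcases key m h5 h4 n (Finset.mem_range.2 hlt) h6 hd with h | ⟨d, h1, h2, h3⟩
    · exact h
    · exfalso
      rw [Finset.mem_range] at h1
      rcases (Nat.dvd_prime hn).1 h3 with h | h <;> omega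
  obtain ⟨h8, h9⟩ := prime_mult h
  have h10 := h.orb_dvd 1
  rw [hB.card] at h10
  have h11 := h.orb_ge hB 1 (h.not_all_fixed hp)
  have hdiv := Nat.dvd_gcd h8 h10
  rcases h7 with rfl | rfl | rfl | rfl | rfl
  · have := Nat.le_of_dvd (by decide) hdiv
    have e : Nat.gcd (59 - 1) 60 = 2 := by decide
    omega
  · have := Nat.le_of_dvd (by decide) hdiv
    have e : Nat.gcd (29 - 1) 60 = 4 := by decide
    omega
  · exfalso
    have e : Nat.gcd (19 - 1) 60 = 6 := by decide
    rw [e] at hdiv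
    have := Nat.le_of_dvd (by decide) hdiv
    have : (h.orb 1).ncard = 6 := by
      generalize (h.orb 1).ncard = s at *
      interval_cases s <;> omega
    rw [this] at h9
    exact no_19 h hB hp h9
  · exact (no_seven h hB hp).elim
  · rfl


theorem sign_addRight_one (n : ℕ) [NeZero n] [DecidableEq (ZMod n)] [Fintype (ZMod n)]
    (hn : Even n) : Equiv.Perm.sign (Equiv.addRight (1 : ZMod n)) = -1 := by
  obtain ⟨k, rfl⟩ : ∃ k, n = k + 1 := ⟨n - 1, by have := NeZero.pos n; omega⟩
  have h1 := sign_finRotate (k + 1)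
  have h2 : (Equiv.addRight (1 : ZMod (k + 1)) : Equiv.Perm (ZMod (k + 1))) =
      (finRotate (k + 1) : Equiv.Perm (Fin (k + 1))) := by
    ext x
    exact (finRotate_apply (n := k + 1) x).symm
  have hk : Odd k := by
    rcases Nat.even_or_odd k with h | h
    · exfalso
      have := h.add_one
      exact (Nat.not_even_iff_odd.2 this) hn
    · exact h
  rw [Nat.add_sub_cancel, hk.neg_one_pow] at h1
  have h3 : ∀ (i1 : DecidableEq (Fin (k + 1))) (i2 : Fintype (Fin (k + 1))),
      @Equiv.Perm.sign _ i1 i2 (finRotate (k + 1)) = -1 := by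
    intro i1 i2
    rw [← h1]
    congr!
  exact (congrArg Equiv.Perm.sign h2).trans (h3 _ _)

namespace SK

variable {B : Type*} [Group B] [Finite B] {φ : Equiv.Perm B} {n : ℕ} [NeZero n]
  {σ : B → ZMod n → ZMod n}

theorem even_case (h : SK φ n σ) (hB : GoodGroup B) (hp : PSkew φ) (hprim : h.Prim)
    (hn : Even n) : False := by
  classical
  let S : B →* ℤˣ :=
    { toFun := fun a => Equiv.Perm.sign (h.perm a)
      map_one' := by
        have : h.perm 1 = 1 := by ext x; exact h.one x
        rw [this, Equiv.Perm.sign_one]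
      map_mul' := fun a b => by
        have : h.perm (a * b) = h.perm b * h.perm a := by
          ext x; exact h.mul a b x
        rw [this, Equiv.Perm.sign_mul, mul_comm] }
  have hS : ∀ a, Equiv.Perm.sign (h.perm a) = 1 := fun a => hB.hom_triv S a
  let s : ZMod n → ℤˣ := fun j => Equiv.Perm.sign (Equiv.addRight j)
  have hs : ∀ a j, s (σ a j) = s j := by
    intro a j
    have : (Equiv.addRight (σ a j) : Equiv.Perm (ZMod n)) * h.perm ((φ ^ j.val) a) =
        h.perm a * Equiv.addRight j := by
      ext x
      exact (h.add a x j).symm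
    have := congrArg Equiv.Perm.sign this
    rw [Equiv.Perm.sign_mul, Equiv.Perm.sign_mul, hS, hS, one_mul, mul_one] at this
    exact this
  have hadd : ∀ i j, s (i + j) = s i * s j := by
    intro i j
    have : (Equiv.addRight (i + j) : Equiv.Perm (ZMod n)) =
        Equiv.addRight i * Equiv.addRight j := by
      ext x
      simp [add_comm, add_left_comm]
    simp only [s]
    rw [this, Equiv.Perm.sign_mul]
  have h0 : s 0 = 1 := by
    have := hadd 0 0
    rw [add_zero] at this
    exact left_eq_mul.1 this
  let D : AddSubgroup (ZMod n) :=
    { carrier := {j | s j = 1}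
      zero_mem' := h0
      add_mem' := fun {i j} hi hj => by
        change s (i + j) = 1
        rw [hadd, show s i = 1 from hi, show s j = 1 from hj, one_mul]
      neg_mem' := fun {i} hi => by
        change s (-i) = 1
        have := hadd i (-i)
        rw [show s i = 1 from hi, one_mul, add_neg_cancel, h0] at this
        exact this.symm }
  have h1 : s 1 = -1 := sign_addRight_one n hn
  have h2 : (2 : ZMod n) ∈ D := by
    change s 2 = 1
    rw [← one_add_one_eq_two, hadd, h1]; rfl
  rcases hprim D (fun a j hj => (hs a j).trans hj) with e | e
  · rw [e, AddSubgroup.mem_bot] at h2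
    have h3 : ((2 : ℕ) : ZMod n) = 0 := by exact_mod_cast h2
    rw [ZMod.natCast_eq_zero_iff] at h3
    have := Nat.le_of_dvd (by norm_num) h3
    have := h.ge_six hB hp
    omega
  · have : (1 : ZMod n) ∈ D := by rw [e]; trivial
    have : s 1 = 1 := this
    rw [h1] at this
    exact absurd this (by decide)

theorem prim_case (h : SK φ n σ) (hB : GoodGroup B) (hp : PSkew φ) (hprim : h.Prim) :
    n = 11 := by
  by_cases hn : n.Prime
  · exact prime_case hn h hB hp
  exfalso
  have h6 := h.ge_six hB hp
  have h1 : (1 : ZMod n) ≠ 0 := by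
    intro e
    have : ((1 : ℕ) : ZMod n) = 0 := by exact_mod_cast e
    rw [ZMod.natCast_eq_zero_iff] at this
    have := Nat.le_of_dvd (by norm_num) this
    omega
  have h2 := h.schur hprim n.minFac (Nat.minFac_prime (by omega)) (Nat.minFac_dvd n)
    (fun e => hn (e ▸ Nat.minFac_prime (by omega))) 1 h1
  have h3 := h.orb_dvd 1
  rw [h2, Set.ncard_compl, Nat.card_zmod, Set.ncard_singleton, hB.card] at h3
  rcases Nat.even_or_odd n with he | ho
  · exact h.even_case hB hp hprim he
  · have hle := Nat.le_of_dvd (by norm_num) h3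
    have : n = 21 := by
      have key : ∀ m ∈ Finset.range 62, 6 ≤ m → m - 1 ∣ 60 → m % 2 = 1 →
          m = 21 ∨ m = 7 ∨ m = 11 ∨ m = 13 ∨ m = 31 ∨ m = 61 := by decide +kernel
      rcases key n (by rw [Finset.mem_range]; omega) h6 h3 (Nat.odd_iff.1 ho) with
        h | h | h | h | h | h
      · exact h
      all_goals exact absurd (by rw [h]; norm_num) hn
    subst this
    exact no_21 h hB hp hprim

theorem res_proper (h : SK φ n σ) (hB : GoodGroup B) (hp : PSkew φ) (d : ZMod n)
    (hd0 : d ≠ 0)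
    (hD : h.Inv (AddSubgroup.zmultiples d : Set (ZMod n))) : PSkew (φ ^ d.val) := by
  have := hB.simple
  refine ⟨⟨h.fix_one d, fun a => ?_⟩, fun hcon => ?_⟩
  · have := hD a d (AddSubgroup.mem_zmultiples d)
    obtain ⟨k, hk⟩ := this
    refine ⟨(k : ZMod n).val, fun b => ?_⟩
    rw [h.rel, ← pow_mul, ← h.pow_natCast (d.val * _)]
    congr 4
    rw [← hk]
    simp [mul_comm]
  · have hfix : ∀ a, σ a d = d := by
      intro a
      apply h.pow_inj
      ext b
      have := h.rel a d b
      rw [hcon] at this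
      exact (mul_left_cancel this).symm
    have hfixD : ∀ x ∈ AddSubgroup.zmultiples d, ∀ a, σ a x = x := by
      rintro x ⟨k, rfl⟩ a
      have := h.fixed_mul d hfix (k : ZMod n).val a
      simpa using this
    have htq := h.triv_quot (AddSubgroup.zmultiples d) hD (by
      intro e
      rw [AddSubgroup.zmultiples_eq_bot] at e
      exact hd0 e)
    let δ : B →* Multiplicative (ZMod n) :=
      { toFun := fun a => Multiplicative.ofAdd (σ a 1 - 1)
        map_one' := by rw [h.one, sub_self]; rfl
        map_mul' := fun a b => by
          rw [← ofAdd_add]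
          congr 1
          have h1 := h.add b (σ a 1 - 1) 1
          rw [sub_add_cancel, hfixD _ (htq a 1)] at h1
          rw [h.mul, h1]; ring }
    obtain ⟨a, ha⟩ := h.not_all_fixed hp
    apply ha
    have h2 : Multiplicative.ofAdd (σ a 1 - 1) = 1 := hB.hom_triv δ a
    have : σ a 1 - 1 = 0 := h2
    exact sub_eq_zero.1 this

end SK

theorem exists_pow11 {B : Type*} [Group B] [Finite B] (hB : GoodGroup B) :
    ∀ (n : ℕ) (φ : Equiv.Perm B), orderOf φ = n → PSkew φ →
      ∃ k : ℕ, orderOf (φ ^ k) = 11 ∧ PSkew (φ ^ k) := by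
  intro n
  induction n using Nat.strong_induction_on with
  | _ n ih =>
  intro φ hn hp
  obtain ⟨σ, h⟩ := hp.1.exists_SK
  have : NeZero (orderOf φ) := ⟨(orderOf_pos φ).ne'⟩
  by_cases hprim : h.Prim
  · exact ⟨1, by rw [pow_one]; exact h.prim_case hB hp hprim, by rwa [pow_one]⟩
  · simp only [SK.Prim] at hprim
    push Not at hprim
    obtain ⟨D, hD, hbot, htop⟩ := hprim
    obtain ⟨⟨d, hdD⟩, hgen⟩ := IsAddCyclic.exists_generator (α := D)
    have hDd : D = AddSubgroup.zmultiples d := by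
      apply le_antisymm
      · intro x hx
        obtain ⟨k, hk⟩ := hgen ⟨x, hx⟩
        exact ⟨k, congrArg Subtype.val hk⟩
      · rw [AddSubgroup.zmultiples_le]; exact hdD
    subst hDd
    have hd0 : d ≠ 0 := fun e => hbot (AddSubgroup.zmultiples_eq_bot.2 e)
    have hpp := h.res_proper hB hp d hd0 hD
    have hlt : orderOf (φ ^ d.val) < n := by
      rw [orderOf_pow]
      have hpos := orderOf_pos φ
      have hg : Nat.gcd (orderOf φ) d.val ≠ 1 := by
        intro e
        apply htop
        have hu := (ZMod.isUnit_iff_coprime d.val (orderOf φ)).2 (Nat.Coprime.symm e)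
        rw [ZMod.natCast_rightInverse d] at hu
        obtain ⟨e, he⟩ := hu.exists_left_inv
        rw [eq_top_iff]
        intro x _
        refine ⟨((x * e).val : ℤ), ?_⟩
        simp [mul_assoc, he]
      have hg0 : 0 < Nat.gcd (orderOf φ) d.val := Nat.gcd_pos_of_pos_left _ hpos
      calc orderOf φ / Nat.gcd (orderOf φ) d.val < orderOf φ := Nat.div_lt_self hpos (by omega)
        _ = n := hn
    obtain ⟨k, hk1, hk2⟩ := ih _ hlt _ rfl hpp
    exact ⟨d.val * k, by rwa [pow_mul], by rwa [pow_mul]⟩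

theorem order_eq_11 {B : Type*} [Group B] [Finite B] (hB : GoodGroup B) (φ : Equiv.Perm B)
    (hp : PSkew φ) : orderOf φ = 11 := by
  classical
  have := hB.simple
  obtain ⟨σ, h⟩ := hp.1.exists_SK
  obtain ⟨k, hk11, hkp⟩ := exists_pow11 hB _ φ rfl hp
  generalize hn : orderOf φ = n at *
  have : NeZero n := ⟨by rw [← hn]; exact (orderOf_pos φ).ne'⟩
  have h6 := h.ge_six hB hp
  set κ : ZMod n := (k : ZMod n) with hκ
  have hψ : φ ^ κ.val = φ ^ k := h.pow_natCast k
  have hσκ : ∀ a, σ a κ ∈ AddSubgroup.zmultiples κ := by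
    intro a
    obtain ⟨m, hm⟩ := hkp.1.2 a
    refine ⟨m, ?_⟩
    change (m : ℤ) • κ = _
    apply h.pow_inj
    have e : ((m : ℤ) • κ) = ((k * m : ℕ) : ZMod n) := by simp [hκ, mul_comm]
    rw [e, h.pow_natCast, pow_mul]
    ext b
    have h1 := h.rel a κ b
    rw [hψ, hm] at h1
    exact mul_left_cancel h1
  have hmul : ∀ (m : ℕ) (a : B), σ a (m * κ) ∈ AddSubgroup.zmultiples κ := by
    intro m
    induction m with
    | zero => intro a; simp [h.zero]
    | succ m ih =>
      intro a
      rw [Nat.cast_add, Nat.cast_one, add_mul, one_mul, h.add]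
      exact add_mem (ih _) (hσκ a)
  have hrep : ∀ y ∈ AddSubgroup.zmultiples κ, ∃ m : ℕ, y = m * κ := by
    rintro y ⟨m, rfl⟩
    exact ⟨(m : ZMod n).val, by simp⟩
  have hD : h.Inv (AddSubgroup.zmultiples κ : Set (ZMod n)) := by
    intro a y hy
    obtain ⟨m, rfl⟩ := hrep y hy
    exact hmul m a
  have hκ0 : κ ≠ 0 := by
    intro e
    rw [e, ZMod.val_zero, pow_zero] at hψ
    rw [← hψ, orderOf_one] at hk11
    omega
  have h11κ : (11 : ZMod n) * κ = 0 := by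
    have h1 : φ ^ (k * 11) = 1 := by rw [pow_mul, ← hk11, pow_orderOf_eq_one]
    have h2 := orderOf_dvd_of_pow_eq_one h1
    rw [hn, ← ZMod.natCast_eq_zero_iff] at h2
    push_cast at h2
    rw [mul_comm]; exact h2
  have htq := h.triv_quot (AddSubgroup.zmultiples κ) hD (by
      intro e
      rw [AddSubgroup.zmultiples_eq_bot] at e
      exact hκ0 e)
  have h11 : ∀ a x, (11 : ZMod n) * σ a x = 11 * x := by
    intro a x
    obtain ⟨m, hm⟩ := hrep _ (htq a x)
    have : σ a x = x + m * κ := by rw [← hm]; ring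
    rw [this, mul_add, mul_left_comm, h11κ]; simp
  have : Fact (Nat.Prime 11) := ⟨by norm_num⟩
  have hfix : ∀ x a, σ a (11 * x) = 11 * x := by
    intro x a
    set T := (h.orb x).toFinset with hT
    have hTm : ∀ t ∈ T, (11 : ZMod n) * t = 11 * x := by
      intro t ht
      have : t ∈ h.orb x := by simpa [hT] using ht
      obtain ⟨b, rfl⟩ := this
      exact h11 b x
    have h1 := h.frob 11 T (by simpa [hT] using h.orb_inv x) a (11 * x)
    have h2 : T.filter (fun t => ((11 : ℕ) : ZMod n) * t = 11 * x) = T := by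
      apply Finset.filter_true_of_mem
      intro t ht
      push_cast
      exact hTm t ht
    have hTd : T.card ∣ 60 := by
      have := h.orb_dvd x
      rwa [hB.card, Set.ncard_eq_toFinset_card'] at this
    have hne : (T.card : ZMod 11) ≠ 0 := by
      intro e
      rw [ZMod.natCast_eq_zero_iff] at e
      have := e.trans hTd
      omega
    rw [h2] at h1
    rw [← h1] at hne
    have h3 : (T.filter (fun t => ((11 : ℕ) : ZMod n) * t = σ a (11 * x))).Nonempty := by
      rw [Finset.nonempty_iff_ne_empty]
      intro e
      rw [e] at hne
      simp at hne
    obtain ⟨t, ht⟩ := h3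
    rw [Finset.mem_filter] at ht
    rw [← ht.2]
    push_cast
    exact hTm t ht.1
  let E : AddSubgroup (ZMod n) := (AddMonoidHom.mulLeft (11 : ZMod n)).range
  have hEfix : ∀ y ∈ E, ∀ a, σ a y = y := by
    rintro y ⟨x, rfl⟩ a
    exact hfix x a
  by_cases hE : E = ⊥
  · have h1 : (11 : ZMod n) ∈ E := ⟨1, mul_one _⟩
    rw [hE, AddSubgroup.mem_bot] at h1
    have h2 : ((11 : ℕ) : ZMod n) = 0 := by exact_mod_cast h1
    rw [ZMod.natCast_eq_zero_iff] at h2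
    rcases (Nat.dvd_prime (by norm_num)).1 h2 with e | e
    · omega
    · exact e
  · exfalso
    have htE := h.triv_quot E (fun a y hy => by
      have := hEfix y hy a
      rw [this]; exact hy) hE
    obtain ⟨a, ha⟩ := h.not_all_fixed hp
    have hy1 := htq a 1
    have hy2 := htE a 1
    have hy0 : σ a 1 - 1 ≠ 0 := sub_ne_zero.2 ha
    generalize σ a 1 - 1 = y at *
    obtain ⟨m, rfl⟩ := hrep y hy1
    have hcop : Nat.Coprime m 11 := by
      rw [Nat.coprime_comm, Nat.Prime.coprime_iff_not_dvd (by norm_num)]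
      rintro ⟨c, rfl⟩
      apply hy0
      push_cast
      rw [mul_right_comm, h11κ, zero_mul]
    have hκE : κ ∈ E := by
      obtain ⟨m', hm'⟩ := Nat.exists_mul_mod_eq_one_of_coprime hcop (by norm_num)
      have e : κ = m' • ((m : ZMod n) * κ) := by
        have h1 : m * m' = 11 * (m * m' / 11) + 1 := by omega
        have h2 : (m : ZMod n) * m' = 11 * ((m * m' / 11 : ℕ) : ZMod n) + 1 := by
          exact_mod_cast congrArg (Nat.cast : ℕ → ZMod n) h1
        rw [nsmul_eq_mul, ← mul_assoc, mul_comm (m' : ZMod n), h2, add_mul, mul_right_comm,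
          h11κ]
        simp
      rw [e]
      exact nsmul_mem hy2 _
    apply hkp.2
    intro a b
    have h1 := h.rel a κ b
    rwa [hEfix κ hκE, hψ] at h1


namespace A5

/-- The `i`-th octal digit. -/
def dig (p i : ℕ) : ℕ := Nat.mod (Nat.div p (Nat.pow 8 i)) 8

/-- Composition of permutations encoded by octal digits. -/
def cmp (p q : ℕ) : ℕ :=
  Nat.add (dig p (dig q 0)) (Nat.add (Nat.mul 8 (dig p (dig q 1)))
    (Nat.add (Nat.mul 64 (dig p (dig q 2))) (Nat.add (Nat.mul 512 (dig p (dig q 3)))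
      (Nat.mul 4096 (dig p (dig q 4))))))

/-- Code of a permutation. -/
def enc (a : Equiv.Perm (Fin 5)) : ℕ :=
  (a 0).val + 8 * (a 1).val + 64 * (a 2).val + 512 * (a 3).val + 4096 * (a 4).val

theorem dig_enc (a : Equiv.Perm (Fin 5)) (i : Fin 5) : dig (enc a) i.val = (a i).val := by
  show (enc a / 8 ^ i.val) % 8 = _
  unfold enc
  have h0 := (a 0).isLt
  have h1 := (a 1).isLt
  have h2 := (a 2).isLt
  have h3 := (a 3).isLt
  have h4 := (a 4).isLt
  fin_cases i <;> simp <;> omega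

theorem enc_mul (a b : Equiv.Perm (Fin 5)) : enc (a * b) = cmp (enc a) (enc b) := by
  have h0 : dig (enc b) 0 = _ := dig_enc b 0
  have h1 : dig (enc b) 1 = _ := dig_enc b 1
  have h2 : dig (enc b) 2 = _ := dig_enc b 2
  have h3 : dig (enc b) 3 = _ := dig_enc b 3
  have h4 : dig (enc b) 4 = _ := dig_enc b 4
  unfold cmp
  rw [h0, h1, h2, h3, h4]
  simp only [dig_enc]
  show _ = _ + (8 * _ + (64 * _ + (512 * _ + 4096 * _)))
  rw [enc]
  simp only [Equiv.Perm.mul_apply]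
  omega

theorem enc_inj {a b : Equiv.Perm (Fin 5)} (h : enc a = enc b) : a = b := by
  ext i
  rw [← dig_enc, ← dig_enc, h]

/-- Codes of the even permutations, ordered by the orbits of a skew morphism. -/
def tbl : List ℕ :=
  [5344, 668, 16467, 14346, 9985, 14416, 1802, 8417, 5148, 17027, 2138, 8459, 13345, 5764,
  17104, 12386, 9740, 17601, 6296, 787, 6163, 13058, 9824, 1228, 16537, 17419, 14465, 5904,
  738, 8284, 12428, 17937, 6338, 8984, 1123, 16922, 10307, 13576, 1697, 4308, 12820, 17986,
  10440, 1305, 4259, 16586, 10265, 5379, 12960, 1620, 2187, 12561, 5666, 8900, 17496,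
  18056, 2257, 4378, 8739, 13380]

theorem tbl_nodup : tbl.Nodup := by decide +kernel

theorem enc_mem : ∀ a : Equiv.Perm (Fin 5), Equiv.Perm.sign a = 1 → enc a ∈ tbl := by
  decide +kernel

/-- The shift on indices. -/
def sh (k n : ℕ) : ℕ := if n < 55 then Nat.mod (Nat.add n (Nat.mul 5 k)) 55 else n

/-- Table lookup. -/
def tb (n : ℕ) : ℕ := tbl.getD n 0

/-- Right multiplication by the 5-cycle. -/
def rot (p : ℕ) : ℕ := Nat.add (Nat.div p 8) (Nat.mul 4096 (Nat.mod p 8))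

/-- Rotations of a code. -/
def rots (p : ℕ) : List ℕ := [p, rot p, rot (rot p), rot (rot (rot p)), rot (rot (rot (rot p)))]

/-- Check of the skew condition on the orbit of `u`. -/
def skewChk : Bool :=
  (List.range 11).all fun l => (List.range 11).any fun k => (List.range 60).all fun b =>
    Nat.beq (tb (sh 1 (tbl.idxOf (cmp (tb (Nat.mul 5 l)) (tb b)))))
      (cmp (tb (sh 1 (Nat.mul 5 l))) (tb (sh k b)))

theorem skewChk_true : skewChk = true := by decide +kernel

/-- Check of the skew condition at the 5-cycle. -/
def gChk : Bool :=
  (List.range 60).all fun b =>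
    Nat.beq (tb (sh 1 (tbl.idxOf (cmp 2257 (tb b))))) (cmp 2257 (tb (sh 3 b)))

theorem gChk_true : gChk = true := by decide +kernel

/-- Check of the structure of the table. -/
def tblChk : Bool :=
  (List.range 12).all fun l => (List.range 4).all fun j =>
    Nat.beq (rot (tb (Nat.add (Nat.mul 5 l) j))) (tb (Nat.add (Nat.mul 5 l) (Nat.succ j)))

theorem tblChk_true : tblChk = true := by decide +kernel

/-- Two-sided multiplication by powers of the 5-cycle. -/
def gxg (p : ℕ) : ℕ := cmp 2257 (rot p)

/-- The orbit of `u`. -/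
def orb (x y : ℕ) : List ℕ :=
  [5344, x, gxg (gxg (gxg y)), gxg (gxg (gxg (gxg x))), gxg x, gxg (gxg x), gxg (gxg y), gxg y,
    gxg (gxg (gxg (gxg y))), gxg (gxg (gxg x)), y]

/-- Membership. -/
def memb (p : ℕ) (l : List ℕ) : Bool := l.any fun q => Nat.beq p q

/-- Distinctness of cosets. -/
def dist (x y : ℕ) : Bool :=
  !(memb y (rots 18056)) && !(memb y (rots 5344)) &&
  !(memb y (rots x)) && !(memb y (rots (gxg x))) && !(memb y (rots (gxg (gxg x)))) &&
  !(memb y (rots (gxg (gxg (gxg x))))) && !(memb y (rots (gxg (gxg (gxg (gxg x))))))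

/-- Skew condition at index `i`. -/
def chk1 (c : List ℕ) (x k i : ℕ) : Bool :=
  (List.range 11).all fun l => (List.range 5).all fun j =>
    !(Nat.beq (cmp 5344 (c.getD i 0)) ((rots (c.getD l 0)).getD j 0)) ||
    Nat.beq ((rots (c.getD (Nat.mod (Nat.succ l) 11) 0)).getD j 0)
      (cmp x (c.getD (Nat.mod (Nat.add i k) 11) 0))

/-- Full necessary condition. -/
def chk (x y k : ℕ) : Bool :=
  Nat.beq (cmp x ((orb x y).getD k 0)) 18056 && chk1 (orb x y) x k 1 && chk1 (orb x y) x k 2 &&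
    chk1 (orb x y) x k 3

/-- The exhaustive check. -/
def allChk : Bool :=
  (rots 14416).all fun x => tbl.all fun y => !(dist x y) || ((List.range 11).all fun k =>
    !(chk x y k) || (Nat.beq x 14416 && Nat.beq y 2187))

theorem allChk_true : allChk = true := by decide +kernel

end A5


section Fixed
variable {B : Type*} [Group B] [Finite B] {φ : Equiv.Perm B}

theorem exists_SK11 (hB : GoodGroup B) (hp : PSkew φ) :
    ∃ σ : B → ZMod 11 → ZMod 11, SK φ 11 σ := by
  obtain ⟨σ, h⟩ := hp.1.exists_SK
  revert σ
  rw [order_eq_11 hB φ hp]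
  exact fun σ h => ⟨σ, h⟩

theorem fix_card (hB : GoodGroup B) (hp : PSkew φ) {σ : B → ZMod 11 → ZMod 11}
    (h : SK φ 11 σ) : ∃ F : Subgroup B, Nat.card F = 5 ∧ ∀ a, a ∈ F ↔ φ a = a := by
  have z1 : ((11 : ℕ) : ZMod 11) * 1 = 0 := by decide
  have z2 : (1 : ZMod 11) ≠ 0 := by decide
  have : Fact (Nat.Prime 11) := ⟨by norm_num⟩
  have hj : ∀ a, (φ ^ (1 : ZMod 11).val) a = a → ∃ k : ℕ, σ a 1 = k * 1 :=
    fun a _ => ⟨(σ a 1).val, by simp⟩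
  refine ⟨h.fixS 1 hj, ?_, fun a => ?_⟩
  · have h1 := h.fixS_card 1 hj 11 z1
    have h2 : h.fixS 1 hj ≠ ⊤ := h.fixS_ne 1 hj z2
    have h3 := (h.fixS 1 hj).card_subgroup_dvd_card
    have h4 : Nat.card (h.fixS 1 hj) ≠ Nat.card B := fun e => h2 (Subgroup.eq_top_of_card_eq _ e)
    rw [hB.card] at h1 h3 h4
    have h5 := Nat.le_of_dvd (by norm_num) h3
    unfold Nat.ModEq at h1
    generalize Nat.card (h.fixS 1 hj) = c at *
    interval_cases c <;> first | rfl | omega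
  · rw [h.mem_fixS, h.pow_one']

theorem fix_sigma {σ : B → ZMod 11 → ZMod 11} (h : SK φ 11 σ) (a : B) (ha : φ a = a)
    (x : ZMod 11) : σ a x = x * σ a 1 := by
  have := h.fix_lin 1 a (by rwa [h.pow_one']) x.val
  simpa using this

theorem exists_g (hB : GoodGroup B) (hp : PSkew φ) :
    ∃ g : B, (g ≠ 1 ∧ g ^ 5 = 1) ∧ ∀ b, φ (g * b) = g * (φ ^ 3) b := by
  obtain ⟨σ, h⟩ := exists_SK11 hB hp
  obtain ⟨F, hF, hm⟩ := fix_card hB hp h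
  have : Nontrivial F := (Finite.one_lt_card_iff_nontrivial).1 (by omega)
  obtain ⟨f, hf⟩ := exists_ne (1 : F)
  have hf5 : (f : B) ^ 5 = 1 := by
    have := pow_card_eq_one' (x := f)
    rw [hF] at this
    exact_mod_cast congrArg Subtype.val this
  have hf1 : (f : B) ≠ 1 := fun e => hf (Subtype.ext e)
  have hff : φ f = f := (hm f).1 f.2
  have hpow : ∀ k : ℕ, ∀ x, σ ((f : B) ^ k) x = x * (σ f 1) ^ k := by
    intro k
    induction k with
    | zero => intro x; simp [h.one]
    | succ k ih => intro x; rw [pow_succ, h.mul, fix_sigma h _ hff, ih, pow_succ, mul_assoc]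
  have ht : ∀ t : ZMod 11, t ^ 5 = 1 → t ≠ 1 → ∃ k < 5, t ^ k = 3 := by decide
  obtain ⟨k, -, hk⟩ := ht (σ f 1) (by
      have := hpow 5 1
      rw [hf5, h.one, one_mul] at this
      exact this.symm) (fun e => hf1 (h.faithful hB hp f (fun x => by
        rw [fix_sigma h _ hff, e, mul_one])))
  have h3 : σ ((f : B) ^ k) 1 = 3 := by rw [hpow, hk, one_mul]
  have hfk : φ ((f : B) ^ k) = (f : B) ^ k := (hm _).1 (pow_mem f.2 k)
  refine ⟨(f : B) ^ k, ⟨fun e => ?_, ?_⟩, fun b => ?_⟩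
  · rw [e, h.one] at h3
    exact absurd h3 (by decide)
  · rw [← pow_mul, mul_comm, pow_mul, hf5, one_pow]
  · have := h.rel ((f : B) ^ k) 1 b
    rw [h3, h.pow_one', hfk] at this
    exact this

theorem unique_g (hB : GoodGroup B) (hp : PSkew φ) {g gg : B}
    (hg : ∀ b, φ (g * b) = g * (φ ^ 3) b) (hgg : ∀ b, φ (gg * b) = gg * (φ ^ 3) b) : g = gg := by
  obtain ⟨σ, h⟩ := exists_SK11 hB hp
  have key : ∀ g : B, (∀ b, φ (g * b) = g * (φ ^ 3) b) → ∀ x, σ g x = x * 3 := by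
    intro g hg x
    have h1 : (φ ^ 3) 1 = 1 := h.fix_one 3
    have hf : φ g = g := by
      have := hg 1
      rwa [h1, mul_one] at this
    rw [fix_sigma h g hf]
    congr 1
    apply h.pow_inj
    ext b
    have h2 := h.rel g 1 b
    rw [h.pow_one', hg, hf] at h2
    exact (mul_left_cancel h2).symm
  exact h.inj_left hB hp g gg (fun x => by rw [key g hg, key gg hgg])

/-- Proper skew permutations with prescribed distinguished fixed point. -/
structure SG (g : B) (φ : Equiv.Perm B) : Prop where
  psk : PSkew φ
  rel : ∀ b, φ (g * b) = g * (φ ^ 3) b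

namespace SG
variable {g : B}

theorem pow11 (hB : GoodGroup B) (h : SG g φ) : φ ^ 11 = 1 := by
  rw [← order_eq_11 hB φ h.psk, pow_orderOf_eq_one]

theorem rel_pow (h : SG g φ) (j : ℕ) (b : B) : (φ ^ j) (g * b) = g * (φ ^ (3 * j)) b := by
  induction j generalizing b with
  | zero => simp
  | succ j ih =>
    rw [pow_succ, Equiv.Perm.mul_apply, h.rel, ih, mul_add, pow_add, Equiv.Perm.mul_apply, mul_one]

theorem fix_g (h : SG g φ) : φ g = g := by
  have h1 : (φ ^ 3) 1 = 1 := Function.IsFixedPt.perm_pow (e := φ) h.psk.1.1 3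
  have := h.rel 1
  rwa [h1, mul_one] at this

theorem rmul (h : SG g φ) {f : B} (hf : φ f = f) (j : ℕ) (b : B) :
    (φ ^ j) (b * f) = (φ ^ j) b * f := by
  obtain ⟨k, hk⟩ := h.psk.1.pow_rel j b
  rw [hk]
  congr 1
  exact Function.IsFixedPt.perm_pow (e := φ) hf k

theorem fix_iff (hB : GoodGroup B) (h : SG g φ) (hg : g ≠ 1 ∧ g ^ 5 = 1) (a : B) :
    φ a = a ↔ a ∈ Subgroup.zpowers g := by
  obtain ⟨σ, hs⟩ := exists_SK11 hB h.psk
  obtain ⟨F, hF, hm⟩ := fix_card hB h.psk hs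
  have : Fact (Nat.Prime 5) := ⟨by norm_num⟩
  have e : Subgroup.zpowers g = F := by
    apply Subgroup.eq_of_le_of_card_ge
    · rw [Subgroup.zpowers_le]
      exact (hm g).2 h.fix_g
    · rw [hF, Nat.card_zpowers, orderOf_eq_prime hg.2 hg.1]
  rw [e, hm]

theorem fix_pow5 (hB : GoodGroup B) (h : SG g φ) (hg : g ≠ 1 ∧ g ^ 5 = 1) {f : B}
    (hf : φ f = f) : f ^ 5 = 1 := by
  obtain ⟨k, rfl⟩ := Subgroup.mem_zpowers_iff.1 ((h.fix_iff hB hg f).1 hf)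
  rw [← zpow_natCast, ← zpow_mul, mul_comm, zpow_mul, zpow_natCast, hg.2, one_zpow]

theorem dist (hB : GoodGroup B) (h : SG g φ) (hg : g ≠ 1 ∧ g ^ 5 = 1) {u : B} (hu : φ u ≠ u)
    {i k : ℕ} {f : B} (hf : φ f = f) (e : (φ ^ i) u = (φ ^ k) u * f) : i ≡ k [MOD 11] := by
  set w := (φ ^ k) u with hw
  have h11 := h.pow11 hB
  have h1 : (φ ^ (i + 10 * k)) w = w * f := by
    rw [hw, ← Equiv.Perm.mul_apply, ← pow_add, add_assoc, pow_add, ← e]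
    have : 10 * k + k = 11 * k := by ring
    rw [this, pow_mul, h11, one_pow, mul_one]
  have h2 : ∀ n : ℕ, ((φ ^ (i + 10 * k)) ^ n) w = w * f ^ n := by
    intro n
    induction n with
    | zero => simp
    | succ n ih =>
      have hfn : φ (f ^ n) = f ^ n := by
        rw [h.fix_iff hB hg] at hf ⊢
        exact pow_mem hf n
      rw [pow_succ', Equiv.Perm.mul_apply, ih, h.rmul hfn, h1, pow_succ', mul_assoc]
  have h3 := h2 11
  rw [← pow_mul, mul_comm (i + 10 * k), pow_mul, h11, one_pow, Equiv.Perm.one_apply] at h3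
  have h4 : f ^ 11 = 1 := by
    have : w * 1 = w * f ^ 11 := by rw [mul_one]; exact h3
    exact (mul_left_cancel this).symm
  have h5 := h.fix_pow5 hB hg hf
  have h6 : f = 1 := by
    have : f ^ 11 = (f ^ 5) ^ 2 * f := by group
    rw [this, h5, one_pow, one_mul] at h4
    exact h4
  rw [h6, mul_one] at h1
  by_contra hne
  have hc : Nat.Coprime (i + 10 * k) 11 := by
    refine (Nat.coprime_comm.1 ((Nat.Prime.coprime_iff_not_dvd (by norm_num)).2 ?_))
    intro hd
    apply hne
    unfold Nat.ModEq
    omega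
  have h7 : φ w = w := by
    obtain ⟨m, hm⟩ := exists_pow_eq_self_of_coprime (x := φ) (n := i + 10 * k)
      (by rw [order_eq_11 hB φ h.psk]; exact hc)
    rw [← hm]
    exact Function.IsFixedPt.perm_pow (e := φ ^ (i + 10 * k)) h1 m
  apply hu
  rw [hw, ← Equiv.Perm.mul_apply, ← pow_succ', pow_succ, Equiv.Perm.mul_apply] at h7
  exact (φ ^ k).injective h7

theorem cover (hB : GoodGroup B) (h : SG g φ) (hg : g ≠ 1 ∧ g ^ 5 = 1) {u : B} (hu : φ u ≠ u)
    (b : B) : φ b = b ∨ ∃ l : ℕ, ∃ f : B, φ f = f ∧ b = (φ ^ l) u * f := by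
  classical
  have : Fact (Nat.Prime 5) := ⟨by norm_num⟩
  have := Fintype.ofFinite B
  let m : Option (Fin 11) × Subgroup.zpowers g → B := fun p => match p.1 with
    | none => p.2.1
    | some l => (φ ^ l.val) u * p.2.1
  have hmem : ∀ f : Subgroup.zpowers g, φ f.1 = f.1 := fun f => (h.fix_iff hB hg _).2 f.2
  have hno : ∀ (l : ℕ) (f f' : Subgroup.zpowers g), (φ ^ l) u * f.1 ≠ f'.1 := by
    intro l f f' e
    apply hu
    have h1 : φ ((φ ^ l) u) = (φ ^ l) u := by
      rw [h.fix_iff hB hg]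
      have := mul_mem f'.2 (inv_mem f.2)
      rwa [← e, mul_inv_cancel_right] at this
    rw [← Equiv.Perm.mul_apply, ← pow_succ', pow_succ, Equiv.Perm.mul_apply] at h1
    exact (φ ^ l).injective h1
  have hinj : Function.Injective m := by
    rintro ⟨_ | l, f⟩ ⟨_ | l', f'⟩ e
    · have : f = f' := Subtype.ext e
      rw [this]
    · exact absurd e.symm (hno l'.val f' f)
    · exact absurd e (hno l.val f f')
    · have e' : (φ ^ l.val) u * f.1 = (φ ^ l'.val) u * f'.1 := e
      have h1 : (φ ^ l.val) u = (φ ^ l'.val) u * (f' * f⁻¹ : Subgroup.zpowers g).1 := by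
        rw [Subgroup.coe_mul, Subgroup.coe_inv, ← mul_assoc, ← e', mul_inv_cancel_right]
      have h2 := h.dist hB hg hu (hmem _) h1
      have h3 : l = l' := by
        apply Fin.ext
        unfold Nat.ModEq at h2
        omega
      subst h3
      have : f = f' := Subtype.ext (mul_left_cancel e')
      rw [this]
  have hcard : Nat.card (Option (Fin 11) × Subgroup.zpowers g) = Nat.card B := by
    rw [Nat.card_prod, Nat.card_zpowers, orderOf_eq_prime hg.2 hg.1, hB.card]
    simp
  have hbij := (Nat.bijective_iff_injective_and_card m).2 ⟨hinj, hcard⟩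
  obtain ⟨⟨_ | l, f⟩, e⟩ := hbij.2 b
  · left
    rw [← e]
    exact hmem f
  · exact Or.inr ⟨l.val, f.1, hmem f, e.symm⟩

theorem pow (hB : GoodGroup B) (h : SG g φ) (m : ℕ) (hm : ¬ 11 ∣ m) : SG g (φ ^ m) := by
  obtain ⟨σ, hs⟩ := exists_SK11 hB h.psk
  have : Fact (Nat.Prime 11) := ⟨by norm_num⟩
  refine ⟨?_, fun b => by rw [h.rel_pow, mul_comm 3 m, pow_mul]⟩
  rw [← hs.pow_natCast]
  refine hs.res_proper hB h.psk _ (fun e => hm ((ZMod.natCast_eq_zero_iff _ _).1 e)) ?_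
  intro a x _
  have h0 : (m : ZMod 11) ≠ 0 := fun e => hm ((ZMod.natCast_eq_zero_iff _ _).1 e)
  refine ⟨((σ a x / m : ZMod 11).val : ℤ), ?_⟩
  simp [h0]

theorem conj (h : SG g φ) (e : B ≃* B) : SG (e g) (e.toEquiv.permCongr φ) := by
  have hp : ∀ k : ℕ, ∀ b, ((e.toEquiv.permCongr φ) ^ k) (e b) = e ((φ ^ k) b) := by
    intro k
    induction k with
    | zero => intro b; rfl
    | succ k ih =>
      intro b
      rw [pow_succ', Equiv.Perm.mul_apply, ih, pow_succ', Equiv.Perm.mul_apply]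
      simp
  have h1 : ∀ b, (e.toEquiv.permCongr φ) (e b) = e (φ b) := fun b => by simp
  refine ⟨⟨⟨?_, fun a => ?_⟩, fun hc => h.psk.2 fun a b => ?_⟩, fun b => ?_⟩
  · have := h1 1
    rwa [h.psk.1.1, map_one e] at this
  · obtain ⟨a, rfl⟩ := e.surjective a
    obtain ⟨k, hk⟩ := h.psk.1.2 a
    refine ⟨k, fun b => ?_⟩
    obtain ⟨b, rfl⟩ := e.surjective b
    rw [← map_mul, h1, hk, h1, hp, map_mul]
  · have := hc (e a) (e b)
    rw [← map_mul, h1, h1, h1, ← map_mul] at this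
    exact e.injective this
  · obtain ⟨b, rfl⟩ := e.surjective b
    rw [← map_mul, h1, h.rel, hp, map_mul]

theorem card_conj (g : B) (e : B ≃* B) :
    Nat.card {φ : Equiv.Perm B // SG (e g) φ} = Nat.card {φ : Equiv.Perm B // SG g φ} := by
  refine (Nat.card_congr (Equiv.subtypeEquiv e.toEquiv.permCongr fun φ => ⟨fun h => h.conj e,
    fun h => ?_⟩)).symm
  have := h.conj e.symm
  rw [e.symm_apply_apply] at this
  convert this using 1
  ext b
  simp

end SG
end Fixed


namespace A5

/-- The group. -/
abbrev BB : Type := ↥(alternatingGroup (Fin 5))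

theorem cardBB : Nat.card BB = 60 := by
  have := nat_card_alternatingGroup (α := Fin 5)
  rw [this]
  simp
  decide

/-- The standard 5-cycle. -/
def g0 : BB := ⟨finRotate 5, Equiv.Perm.mem_alternatingGroup.2 (by decide +kernel)⟩

/-- An involution inverting it. -/
def u0 : BB := ⟨Equiv.swap 1 4 * Equiv.swap 2 3, Equiv.Perm.mem_alternatingGroup.2 (by decide +kernel)⟩

theorem goodBB : GoodGroup BB :=
  ⟨alternatingGroup.isSimpleGroup (by simp), cardBB, g0, u0, by decide⟩

/-- Code of an even permutation. -/
def encB (a : BB) : ℕ := enc a.1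

theorem encB_mul (a b : BB) : encB (a * b) = cmp (encB a) (encB b) := enc_mul a.1 b.1

theorem encB_inj {a b : BB} (h : encB a = encB b) : a = b := Subtype.ext (enc_inj h)

theorem encB_mem (a : BB) : encB a ∈ tbl := enc_mem a.1 (Equiv.Perm.mem_alternatingGroup.1 a.2)

theorem encB_one : encB 1 = 18056 := by decide
theorem encB_g : encB g0 = 2257 := by decide
theorem encB_u : encB u0 = 5344 := by decide

theorem g0_five : g0 ≠ 1 ∧ g0 ^ 5 = 1 := by
  constructor <;> decide

theorem gug : g0 * u0 * g0 = u0 := by decide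

theorem encB_rot (a : BB) : encB (a * g0) = rot (encB a) := by
  show enc (a.1 * g0.1) = enc a.1 / 8 + 4096 * (enc a.1 % 8)
  have h0 : g0.1 0 = 1 := by decide
  have h1 : g0.1 1 = 2 := by decide
  have h2 : g0.1 2 = 3 := by decide
  have h3 : g0.1 3 = 4 := by decide
  have h4 : g0.1 4 = 0 := by decide
  unfold enc
  simp only [Equiv.Perm.mul_apply, h0, h1, h2, h3, h4]
  have := (a.1 0).isLt
  omega

theorem encB_rots (a : BB) (j : ℕ) (hj : j < 5) :
    (rots (encB a)).getD j 0 = encB (a * g0 ^ j) := by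
  have h : ∀ k, a * g0 ^ (k + 1) = a * g0 ^ k * g0 := fun k => by rw [pow_succ, mul_assoc]
  interval_cases j <;> simp [rots, h, encB_rot]

theorem encB_gxg (a : BB) : gxg (encB a) = encB (g0 * a * g0) := by
  rw [gxg, ← encB_rot, ← encB_g, ← encB_mul, mul_assoc]

theorem length_tbl : tbl.length = 60 := by decide

theorem exists_enc (n : ℕ) (hn : n < 60) : ∃ b : BB, encB b = tb n := by
  classical
  have h1 : Finset.univ.image encB = tbl.toFinset := by
    apply Finset.eq_of_subset_of_card_le
    · intro c hc
      obtain ⟨b, -, rfl⟩ := Finset.mem_image.1 hc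
      exact List.mem_toFinset.2 (encB_mem b)
    · rw [Finset.card_image_of_injective _ (fun a b h => encB_inj h),
        List.toFinset_card_of_nodup tbl_nodup, length_tbl, Finset.card_univ,
        ← Nat.card_eq_fintype_card, cardBB]
  have h2 : tb n ∈ tbl.toFinset := by
    rw [List.mem_toFinset, tb, List.getD_eq_getElem _ _ (by rw [length_tbl]; exact hn)]
    exact List.getElem_mem _
  rw [← h1] at h2
  obtain ⟨b, -, hb⟩ := Finset.mem_image.1 h2
  exact ⟨b, hb⟩

open Classical in
/-- Elements by index. -/
noncomputable def En (n : ℕ) : BB := if h : ∃ b : BB, encB b = tb n then h.choose else 1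

theorem encB_En (n : ℕ) (hn : n < 60) : encB (En n) = tb n := by
  rw [En, dif_pos (exists_enc n hn)]
  exact (exists_enc n hn).choose_spec

/-- Index of an element. -/
def idx (b : BB) : ℕ := tbl.idxOf (encB b)

theorem idx_lt (b : BB) : idx b < 60 := by
  rw [← length_tbl]
  exact List.idxOf_lt_length_of_mem (encB_mem b)

theorem tb_idx (b : BB) : tb (idx b) = encB b := by
  rw [tb, List.getD_eq_getElem _ _ (by rw [length_tbl]; exact idx_lt b)]
  exact List.getElem_idxOf _

theorem En_idx (b : BB) : En (idx b) = b := by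
  apply encB_inj
  rw [encB_En _ (idx_lt b), tb_idx]

theorem idx_En (n : ℕ) (hn : n < 60) : idx (En n) = n := by
  rw [idx, encB_En n hn, tb, List.getD_eq_getElem _ _ (by rw [length_tbl]; exact hn)]
  exact tbl_nodup.idxOf_getElem _ _

theorem sh_def (k n : ℕ) : sh k n = if n < 55 then (n + 5 * k) % 55 else n := rfl

theorem sh_lt (k n : ℕ) (hn : n < 60) : sh k n < 60 := by
  rw [sh_def]; split_ifs <;> omega

theorem sh_sh (k l n : ℕ) : sh k (sh l n) = sh (l + k) n := by
  simp only [sh_def]; split_ifs <;> omega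

theorem sh_zero (n : ℕ) : sh 0 n = n := by
  simp only [sh_def]; split_ifs <;> omega

theorem sh_11 (n : ℕ) : sh 11 n = n := by
  simp only [sh_def]; split_ifs <;> omega

/-- The basic skew morphism. -/
noncomputable def f0 : Equiv.Perm BB where
  toFun b := En (sh 1 (idx b))
  invFun b := En (sh 10 (idx b))
  left_inv b := by
    show En (sh 10 (idx (En (sh 1 (idx b))))) = b
    rw [idx_En _ (sh_lt _ _ (idx_lt b)), sh_sh, sh_11, En_idx]
  right_inv b := by
    show En (sh 1 (idx (En (sh 10 (idx b))))) = b
    rw [idx_En _ (sh_lt _ _ (idx_lt b)), sh_sh, sh_11, En_idx]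

theorem f0_apply (b : BB) : f0 b = En (sh 1 (idx b)) := rfl

theorem f0_pow (k : ℕ) (b : BB) : (f0 ^ k) b = En (sh k (idx b)) := by
  induction k with
  | zero => rw [sh_zero, En_idx]; rfl
  | succ k ih =>
    rw [pow_succ', Equiv.Perm.mul_apply, ih, f0_apply, idx_En _ (sh_lt _ _ (idx_lt b)), sh_sh]

theorem enc_f0 (k : ℕ) (b : BB) : encB ((f0 ^ k) b) = tb (sh k (idx b)) := by
  rw [f0_pow, encB_En _ (sh_lt _ _ (idx_lt b))]

theorem f0_one : f0 1 = 1 := by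
  apply encB_inj
  have := enc_f0 1 1
  rw [pow_one] at this
  rw [this, idx, encB_one]
  decide

theorem f0_g (b : BB) : f0 (g0 * b) = g0 * (f0 ^ 3) b := by
  apply encB_inj
  have h1 := enc_f0 1 (g0 * b)
  rw [pow_one] at h1
  rw [h1, encB_mul, enc_f0, idx, encB_mul, encB_g]
  have h := gChk_true
  simp only [gChk, List.all_eq_true, List.mem_range, Nat.beq_eq] at h
  have := h (idx b) (idx_lt b)
  rwa [tb_idx] at this

theorem f0_x (l : ℕ) (hl : l < 11) :
    ∃ k : ℕ, ∀ b, f0 (En (5 * l) * b) = f0 (En (5 * l)) * (f0 ^ k) b := by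
  have h := skewChk_true
  simp only [skewChk, List.all_eq_true, List.any_eq_true, List.mem_range, Nat.beq_eq] at h
  obtain ⟨k, -, hk⟩ := h l hl
  refine ⟨k, fun b => encB_inj ?_⟩
  have h1 := enc_f0 1 (En (5 * l) * b)
  have h2 := enc_f0 1 (En (5 * l))
  rw [pow_one] at h1 h2
  have h3 := hk (idx b) (idx_lt b)
  rw [h1, encB_mul, enc_f0, h2, idx, encB_mul, encB_En _ (by omega), idx_En _ (by omega), ← tb_idx b]
  exact h3

/-- Elements satisfying the skew condition for all powers. -/
def Good (a : BB) : Prop := ∀ j : ℕ, ∃ k : ℕ, ∀ b, (f0 ^ j) (a * b) = (f0 ^ j) a * (f0 ^ k) b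

theorem Good.mul {a b : BB} (ha : Good a) (hb : Good b) : Good (a * b) := by
  intro j
  obtain ⟨k, hk⟩ := ha j
  obtain ⟨m, hm⟩ := hb k
  exact ⟨m, fun c => by rw [mul_assoc, hk, hm, hk, mul_assoc]⟩

theorem f0_En (l : ℕ) (hl : l < 11) : f0 (En (5 * l)) = En (5 * ((l + 1) % 11)) := by
  rw [f0_apply, idx_En _ (by omega), sh_def, if_pos (by omega)]
  congr 1
  omega

theorem good_x (l : ℕ) (hl : l < 11) : Good (En (5 * l)) := by
  intro j
  induction j generalizing l with
  | zero => exact ⟨0, fun b => by simp⟩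
  | succ j ih =>
    obtain ⟨k, hk⟩ := f0_x l hl
    obtain ⟨m, hm⟩ := ih ((l + 1) % 11) (Nat.mod_lt _ (by norm_num))
    refine ⟨m + k, fun b => ?_⟩
    rw [pow_succ, Equiv.Perm.mul_apply, Equiv.Perm.mul_apply, hk, f0_En l hl, hm, pow_add,
      Equiv.Perm.mul_apply]

theorem good_one : Good 1 := by
  intro j
  refine ⟨j, fun b => ?_⟩
  have : (f0 ^ j) 1 = 1 := Function.IsFixedPt.perm_pow (e := f0) f0_one j
  rw [this, one_mul, one_mul]

theorem good_g : Good g0 := by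
  have key : ∀ (j : ℕ) (b : BB), (f0 ^ j) (g0 * b) = g0 * (f0 ^ (3 * j)) b := by
    intro j
    induction j with
    | zero => intro b; simp
    | succ j ih =>
      intro b
      rw [pow_succ, Equiv.Perm.mul_apply, f0_g, ih, mul_add, pow_add, Equiv.Perm.mul_apply, mul_one]
  intro j
  refine ⟨3 * j, fun b => ?_⟩
  have h1 : (f0 ^ (3 * j)) 1 = 1 := Function.IsFixedPt.perm_pow (e := f0) f0_one _
  have h2 := key j 1
  rw [h1, mul_one] at h2
  rw [h2, key]

theorem En_succ (l j : ℕ) (hl : l < 12) (hj : j < 4) :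
    En (5 * l + (j + 1)) = En (5 * l + j) * g0 := by
  have h := tblChk_true
  simp only [tblChk, List.all_eq_true, List.mem_range, Nat.beq_eq] at h
  apply encB_inj
  rw [encB_rot, encB_En _ (by omega), encB_En _ (by omega)]
  exact (h l hl j hj).symm

theorem En_55 : En 55 = 1 := by
  apply encB_inj
  rw [encB_En _ (by norm_num), encB_one]
  decide

theorem good_all (a : BB) : Good a := by
  have h : ∀ l < 12, ∀ j < 5, Good (En (5 * l + j)) := by
    intro l hl j hj
    induction j with
    | zero =>
      by_cases h11 : l < 11
      · exact good_x l h11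
      · have : l = 11 := by omega
        subst this
        show Good (En 55)
        rw [En_55]
        exact good_one
    | succ j ih =>
      rw [En_succ l j hl (by omega)]
      exact (ih (by omega)).mul good_g
  have h1 := idx_lt a
  have := h (idx a / 5) (by omega) (idx a % 5) (by omega)
  rwa [Nat.div_add_mod, En_idx] at this

theorem idx_u : idx u0 = 0 := by
  rw [idx, encB_u]; decide

theorem sg0 : SG g0 f0 := by
  refine ⟨⟨⟨f0_one, fun a => ?_⟩, fun hc => ?_⟩, f0_g⟩
  · obtain ⟨k, hk⟩ := good_all a 1
    exact ⟨k, fun b => by simpa using hk b⟩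
  · have h1 := hc g0 u0
    have h3 : f0 g0 = g0 := by
      have h1 : (f0 ^ 3) 1 = 1 := Function.IsFixedPt.perm_pow (e := f0) f0_one _
      have := f0_g 1
      rwa [h1, mul_one] at this
    rw [f0_g, h3] at h1
    have h2 := congrArg encB (mul_left_cancel h1)
    have h4 := enc_f0 1 u0
    rw [pow_one] at h4
    rw [enc_f0, h4, idx_u] at h2
    exact absurd h2 (by decide)

end A5


namespace A5

variable {φ : Equiv.Perm BB}

theorem u_not_fixed (h : SG g0 φ) : φ u0 ≠ u0 := fun e =>
  absurd (h.fix_pow5 goodBB g0_five e) (by decide)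

theorem X4 (h : SG g0 φ) (i : ℕ) : (φ ^ (4 * i)) u0 = g0 * (φ ^ i) u0 * g0 := by
  conv_lhs => rw [← gug]
  rw [h.rmul h.fix_g, h.rel_pow]
  have : 3 * (4 * i) = 11 * i + i := by ring
  rw [this, pow_add, pow_mul, h.pow11 goodBB, one_pow, one_mul]

theorem X_mod (h : SG g0 φ) (i j : ℕ) (e : i % 11 = j % 11) : (φ ^ i) u0 = (φ ^ j) u0 := by
  have : φ ^ i = φ ^ j := by
    rw [pow_eq_pow_iff_modEq, order_eq_11 goodBB φ h.psk]
    exact e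
  rw [this]

theorem enc4 (h : SG g0 φ) (i j : ℕ) (e : (4 * i) % 11 = j % 11) :
    encB ((φ ^ j) u0) = gxg (encB ((φ ^ i) u0)) := by
  rw [encB_gxg, ← X4 h, X_mod h _ _ e]

theorem orb_eq (h : SG g0 φ) (i : ℕ) (hi : i < 11) :
    (orb (encB (φ u0)) (encB ((φ ^ 10) u0))).getD i 0 = encB ((φ ^ i) u0) := by
  have e1 : encB ((φ ^ 1) u0) = encB (φ u0) := by rw [pow_one]
  have e4 := enc4 h 1 4 rfl
  have e5 := enc4 h 4 5 rfl
  have e9 := enc4 h 5 9 rfl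
  have e3 := enc4 h 9 3 rfl
  have e7 := enc4 h 10 7 rfl
  have e6 := enc4 h 7 6 rfl
  have e2 := enc4 h 6 2 rfl
  have e8 := enc4 h 2 8 rfl
  rw [e1] at e4
  interval_cases i
  · exact encB_u.symm
  · exact e1.symm
  · rw [e2, e6, e7]; rfl
  · rw [e3, e9, e5, e4]; rfl
  · rw [e4]; rfl
  · rw [e5, e4]; rfl
  · rw [e6, e7]; rfl
  · rw [e7]; rfl
  · rw [e8, e2, e6, e7]; rfl
  · rw [e9, e5, e4]; rfl
  · rfl

theorem mem_rots {c : ℕ} {a : BB} (hc : c ∈ rots (encB a)) : ∃ j < 5, c = encB (a * g0 ^ j) := by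
  obtain ⟨j, hj, e⟩ := List.mem_iff_getElem.1 hc
  have hj5 : j < 5 := hj
  refine ⟨j, hj5, ?_⟩
  rw [← encB_rots a j hj5, List.getD_eq_getElem _ _ hj, e]

theorem memb_iff {c : ℕ} {l : List ℕ} : memb c l = true ↔ c ∈ l := by
  simp [memb, List.any_eq_true, Nat.beq_eq]

theorem fix_gpow (h : SG g0 φ) (j : ℕ) : φ (g0 ^ j) = g0 ^ j :=
  (h.fix_iff goodBB g0_five _).2 (pow_mem (Subgroup.mem_zpowers _) _)

theorem not_coset (h : SG g0 φ) (i k : ℕ) (hik : i % 11 ≠ k % 11) {c d : ℕ}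
    (hc : c = encB ((φ ^ i) u0)) (hd : d = encB ((φ ^ k) u0)) : memb c (rots d) = false := by
  rw [Bool.eq_false_iff]
  intro e
  rw [memb_iff, hd] at e
  obtain ⟨j, -, hj⟩ := mem_rots e
  rw [hc] at hj
  exact hik (h.dist goodBB g0_five (u_not_fixed h) (fix_gpow h j) (encB_inj hj))

theorem not_in_F (h : SG g0 φ) (i : ℕ) {c : ℕ} (hc : c = encB ((φ ^ i) u0)) :
    memb c (rots 18056) = false := by
  rw [Bool.eq_false_iff]
  intro e
  rw [memb_iff, ← encB_one] at e
  obtain ⟨j, -, hj⟩ := mem_rots e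
  rw [hc, one_mul] at hj
  have h1 := fix_gpow h j
  rw [← encB_inj hj, ← Equiv.Perm.mul_apply, ← pow_succ', pow_succ, Equiv.Perm.mul_apply] at h1
  exact u_not_fixed h ((φ ^ i).injective h1)

theorem dist_true (h : SG g0 φ) : dist (encB (φ u0)) (encB ((φ ^ 10) u0)) = true := by
  have e1 : encB (φ u0) = encB ((φ ^ 1) u0) := by rw [pow_one]
  have e0 : 5344 = encB ((φ ^ 0) u0) := encB_u.symm
  have e4 := enc4 h 1 4 rfl
  have e5 := enc4 h 4 5 rfl
  have e9 := enc4 h 5 9 rfl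
  have e3 := enc4 h 9 3 rfl
  rw [dist, e1, ← e4, ← e5, ← e9, ← e3, not_in_F h 10 rfl,
    not_coset h 10 0 (by decide) rfl e0,
    not_coset h 10 1 (by decide) rfl rfl, not_coset h 10 4 (by decide) rfl rfl,
    not_coset h 10 5 (by decide) rfl rfl, not_coset h 10 9 (by decide) rfl rfl,
    not_coset h 10 3 (by decide) rfl rfl]
  rfl

theorem chk1_true (h : SG g0 φ) (k : ℕ) (hk : ∀ b, φ (u0 * b) = φ u0 * (φ ^ k) b) (i : ℕ)
    (hi : i < 11) :
    chk1 (orb (encB (φ u0)) (encB ((φ ^ 10) u0))) (encB (φ u0)) k i = true := by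
  simp only [chk1, List.all_eq_true, List.mem_range, Bool.or_eq_true, Bool.not_eq_true',
    Nat.beq_eq]
  intro l hl j hj
  have m1 : Nat.mod (Nat.succ l) 11 < 11 := Nat.mod_lt _ (by norm_num)
  have m2 : Nat.mod (Nat.add i k) 11 < 11 := Nat.mod_lt _ (by norm_num)
  rw [orb_eq h i hi, orb_eq h l hl, orb_eq h _ m1, orb_eq h _ m2, encB_rots _ _ hj,
    encB_rots _ _ hj, ← encB_mul, ← encB_u, ← encB_mul]
  by_cases e : encB (u0 * (φ ^ i) u0) = encB ((φ ^ l) u0 * g0 ^ j)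
  · right
    have e1 := congrArg φ (encB_inj e)
    have e2 := h.rmul (fix_gpow h j) 1 ((φ ^ l) u0)
    rw [pow_one] at e2
    rw [hk, e2, ← Equiv.Perm.mul_apply, ← Equiv.Perm.mul_apply, ← pow_add, ← pow_succ'] at e1
    rw [X_mod h (Nat.mod (Nat.succ l) 11) (l + 1) (Nat.mod_mod _ _),
      X_mod h (Nat.mod (Nat.add i k) 11) (k + i) (by
        show (i + k) % 11 % 11 = _
        rw [Nat.mod_mod, add_comm]), e1]
  · left
    rw [Bool.eq_false_iff]
    intro e'
    exact e (Nat.eq_of_beq_eq_true e')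

theorem key_eq (h : SG g0 φ) (hx : encB (φ u0) ∈ rots 14416) :
    encB (φ u0) = 14416 ∧ encB ((φ ^ 10) u0) = 2187 := by
  obtain ⟨k', hk'⟩ := h.psk.1.2 u0
  obtain ⟨k, hk11, hk⟩ : ∃ k < 11, ∀ b, φ (u0 * b) = φ u0 * (φ ^ k) b := by
    refine ⟨k' % 11, Nat.mod_lt _ (by norm_num), fun b => ?_⟩
    have := pow_mod_orderOf φ k'
    rw [order_eq_11 goodBB φ h.psk] at this
    rw [this, hk']
  have hA := allChk_true
  simp only [allChk, List.all_eq_true, Bool.or_eq_true, Bool.and_eq_true, Bool.not_eq_true',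
    List.mem_range, Nat.beq_eq] at hA
  have h1 := hA _ hx _ (encB_mem ((φ ^ 10) u0))
  rw [dist_true h] at h1
  have h2 := (h1.resolve_left (by simp)) k hk11
  have hc : chk (encB (φ u0)) (encB ((φ ^ 10) u0)) k = true := by
    rw [chk, chk1_true h k hk 1 (by norm_num), chk1_true h k hk 2 (by norm_num),
      chk1_true h k hk 3 (by norm_num), orb_eq h k hk11, ← encB_mul, ← hk]
    have : u0 * u0 = 1 := by decide
    rw [this, h.psk.1.1, encB_one]
    rfl
  rw [hc] at h2
  exact h2.resolve_left (by simp)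

theorem enc_f0_u (k : ℕ) : encB ((f0 ^ k) u0) = tb (sh k 0) := by rw [enc_f0, idx_u]

theorem eq_f0 (h : SG g0 φ) (hx : encB (φ u0) ∈ rots 14416) : φ = f0 := by
  obtain ⟨h1, h2⟩ := key_eq h hx
  have h3 : encB (f0 u0) = 14416 := by
    have := enc_f0_u 1
    rw [pow_one] at this
    rw [this]; decide
  have h4 : encB ((f0 ^ 10) u0) = 2187 := by rw [enc_f0_u]; decide
  have hX : ∀ i, (φ ^ i) u0 = (f0 ^ i) u0 := by
    intro i
    rw [X_mod h i (i % 11) (Nat.mod_mod _ _).symm, X_mod sg0 i (i % 11) (Nat.mod_mod _ _).symm]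
    have hi : i % 11 < 11 := Nat.mod_lt _ (by norm_num)
    apply encB_inj
    rw [← orb_eq h _ hi, ← orb_eq sg0 _ hi, h1, h2, h3, h4]
  have hfix : ∀ a, f0 a = a → φ a = a := fun a ha =>
    (h.fix_iff goodBB g0_five a).2 ((sg0.fix_iff goodBB g0_five a).1 ha)
  apply Equiv.ext
  intro b
  rcases sg0.cover goodBB g0_five (u_not_fixed sg0) b with hb | ⟨l, f, hf, rfl⟩
  · rw [hb, hfix b hb]
  · have e1 := sg0.rmul hf 1 ((f0 ^ l) u0)
    have e2 := h.rmul (hfix f hf) 1 ((f0 ^ l) u0)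
    rw [pow_one] at e1 e2
    have e3 : φ ((f0 ^ l) u0) = f0 ((f0 ^ l) u0) := by
      have h5 := hX (l + 1)
      rw [pow_succ', pow_succ', Equiv.Perm.mul_apply, Equiv.Perm.mul_apply, hX l] at h5
      exact h5
    rw [e1, e2, e3]

theorem exists_pow_eq (h : SG g0 φ) : ∃ l, φ ^ l = f0 ∧ ¬ 11 ∣ l := by
  have hfix : ∀ a, φ a = a ↔ f0 a = a := fun a =>
    (h.fix_iff goodBB g0_five a).trans (sg0.fix_iff goodBB g0_five a).symm
  rcases h.cover goodBB g0_five (u_not_fixed h) (f0 u0) with hb | ⟨l, f, hf, e⟩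
  · rw [hfix] at hb
    exact absurd (f0.injective hb) (u_not_fixed sg0)
  · have hl : ¬ 11 ∣ l := by
      intro hd
      have e0 : (φ ^ l) u0 = u0 := X_mod h l 0 (by omega)
      rw [e0] at e
      have := sg0.dist goodBB g0_five (u_not_fixed sg0) (i := 1) (k := 0) ((hfix f).1 hf)
        (by rw [pow_one, e]; rfl)
      exact absurd this (by decide)
    refine ⟨l, eq_f0 (h.pow goodBB l hl) ?_, hl⟩
    have h3 : encB (f0 u0) = 14416 := by
      have := enc_f0_u 1
      rw [pow_one] at this
      rw [this]; decide
    have hf' : f⁻¹ ∈ Subgroup.zpowers g0 := inv_mem ((h.fix_iff goodBB g0_five f).1 hf)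
    obtain ⟨j, hj⟩ := (mem_powers_iff_mem_zpowers).2 hf'
    have hj' : g0 ^ (j % 5) = f⁻¹ := by
      rw [← hj]
      show _ = g0 ^ j
      conv_rhs => rw [← Nat.div_add_mod j 5, pow_add, pow_mul, g0_five.2, one_pow, one_mul]
    have e1 : (φ ^ l) u0 = f0 u0 * g0 ^ (j % 5) := by rw [hj', e, mul_inv_cancel_right]
    have hj5 : j % 5 < 5 := Nat.mod_lt _ (by norm_num)
    rw [e1, ← encB_rots _ _ hj5, h3, List.getD_eq_getElem _ _ (by exact hj5)]
    exact List.getElem_mem _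

theorem sg_iff : SG g0 φ ↔ φ ∈ ((Subgroup.zpowers f0 : Set (Equiv.Perm BB)) \ {1}) := by
  constructor
  · intro h
    obtain ⟨l, hl, hd⟩ := exists_pow_eq h
    refine ⟨?_, fun e => ?_⟩
    · obtain ⟨m, hm⟩ := exists_pow_eq_self_of_coprime (x := φ) (n := l) (by
        rw [order_eq_11 goodBB φ h.psk]
        exact Nat.coprime_comm.1 ((Nat.Prime.coprime_iff_not_dvd (by norm_num)).2 hd))
      rw [← hm, hl]
      exact pow_mem (Subgroup.mem_zpowers _) _
    · apply u_not_fixed h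
      rw [Set.mem_singleton_iff.1 e]
      rfl
  · rintro ⟨h1, h2⟩
    obtain ⟨m, hm⟩ := (mem_powers_iff_mem_zpowers).2 h1
    have hm' : f0 ^ m = φ := hm
    rw [← hm']
    apply sg0.pow goodBB
    rintro ⟨c, rfl⟩
    apply h2
    rw [pow_mul, sg0.pow11 goodBB, one_pow] at hm'
    exact hm'.symm

theorem card_g0 : Nat.card {φ : Equiv.Perm BB // SG g0 φ} = 10 := by
  have : {φ : Equiv.Perm BB | SG g0 φ} = (Subgroup.zpowers f0 : Set (Equiv.Perm BB)) \ {1} :=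
    Set.ext fun φ => sg_iff
  show Nat.card ↥({φ : Equiv.Perm BB | SG g0 φ}) = 10
  rw [this, Nat.card_coe_set_eq, Set.ncard_sdiff_singleton_of_mem (one_mem (Subgroup.zpowers f0)),
    ← Nat.card_coe_set_eq]
  have : Nat.card (Subgroup.zpowers f0) = 11 := by
    rw [Nat.card_zpowers, order_eq_11 goodBB f0 sg0.psk]
  show Nat.card (Subgroup.zpowers f0) - 1 = 10
  rw [this]

theorem card_g (g : BB) (hg : g ≠ 1 ∧ g ^ 5 = 1) :
    Nat.card {φ : Equiv.Perm BB // SG g φ} = 10 := by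
  have : Fact (Nat.Prime 5) := ⟨by norm_num⟩
  have ho : ∀ g : BB, (g ≠ 1 ∧ g ^ 5 = 1) → orderOf (g : Equiv.Perm (Fin 5)) = 5 := by
    intro g hg
    rw [Subgroup.orderOf_coe]
    exact orderOf_eq_prime hg.2 hg.1
  have hct : ∀ g : BB, (g ≠ 1 ∧ g ^ 5 = 1) → (g : Equiv.Perm (Fin 5)).cycleType = {5} := by
    intro g hg
    obtain ⟨n, hn⟩ := Equiv.Perm.cycleType_prime_order (σ := (g : Equiv.Perm (Fin 5)))
      (by rw [ho g hg]; norm_num)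
    rw [ho g hg] at hn
    have h1 := Equiv.Perm.sum_cycleType_le (g : Equiv.Perm (Fin 5))
    rw [hn] at h1
    simp at h1
    rw [hn, h1]
    rfl
  have hc : IsConj (g0 : Equiv.Perm (Fin 5)) (g : Equiv.Perm (Fin 5)) := by
    rw [Equiv.Perm.isConj_iff_cycleType_eq, hct g hg, hct g0 g0_five]
  obtain ⟨c, hc⟩ := isConj_iff.1 hc
  have : g = (MulAut.conjNormal c : MulAut BB) g0 := by
    apply Subtype.ext
    rw [MulAut.conjNormal_apply, hc]
  rw [this]
  exact (SG.card_conj g0 (MulAut.conjNormal c : MulAut BB)).trans card_g0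

theorem card_five : Nat.card {g : BB // g ≠ 1 ∧ g ^ 5 = 1} = 24 := by
  rw [Nat.card_eq_fintype_card]
  decide +kernel

theorem card_pskew : Nat.card {φ : Equiv.Perm BB // PSkew φ} = 240 := by
  classical
  choose G hG using fun φ : {φ : Equiv.Perm BB // PSkew φ} => exists_g goodBB φ.2
  let e : {φ : Equiv.Perm BB // PSkew φ} ≃
      (Σ g : {g : BB // g ≠ 1 ∧ g ^ 5 = 1}, {φ : Equiv.Perm BB // SG g.1 φ}) :=
    { toFun := fun φ => ⟨⟨G φ, (hG φ).1⟩, ⟨φ.1, φ.2, (hG φ).2⟩⟩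
      invFun := fun p => ⟨p.2.1, p.2.2.psk⟩
      left_inv := fun φ => rfl
      right_inv := by
        rintro ⟨⟨g, hg⟩, ⟨φ, hφ⟩⟩
        have hp : PSkew φ := hφ.psk
        have : G ⟨φ, hp⟩ = g := unique_g goodBB hp (hG ⟨φ, hp⟩).2 hφ.rel
        subst this
        rfl }
  rw [Nat.card_congr e, Nat.card_sigma]
  rw [Finset.sum_congr rfl (fun g _ => card_g g.1 g.2), Finset.sum_const, Finset.card_univ,
    ← Nat.card_eq_fintype_card, card_five]
  rfl

end A5

theorem proper_iff_pskew {B : Type*} [Group B] (φ : Equiv.Perm B) :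
    IsProperSkewMorphism (φ : B → B) ↔ PSkew φ := by
  have hit : ∀ k : ℕ, (φ : B → B)^[k] = ⇑(φ ^ k) := fun k => Equiv.Perm.iterate_eq_pow φ k
  constructor
  · rintro ⟨⟨-, h1, π, hπ⟩, h2⟩
    exact ⟨⟨h1, fun a => ⟨π a, fun b => by rw [hπ, hit]⟩⟩, h2⟩
  · rintro ⟨⟨h1, h3⟩, h2⟩
    choose π hπ using h3
    exact ⟨⟨φ.bijective, h1, π, fun a b => by rw [hπ, hit]⟩, h2⟩

/-- `Alt(5)` has exactly `240` proper skew morphisms. -/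
theorem stmt_12 :
    Nat.card {φ : ↥(alternatingGroup (Fin 5)) → ↥(alternatingGroup (Fin 5)) //
      IsProperSkewMorphism φ} = 240 := by
  rw [← A5.card_pskew]
  exact Nat.card_congr
    { toFun := fun φ => ⟨Equiv.ofBijective φ.1 φ.2.1.1, (proper_iff_pskew _).1 φ.2⟩
      invFun := fun φ => ⟨φ.1, (proper_iff_pskew _).2 φ.2⟩
      left_inv := fun φ => rfl
      right_inv := fun φ => Subtype.ext (Equiv.ext fun b => rfl) }
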